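/- Let n, m ≥ 1 and for j = 1,…,m let Ω_j : ℝⁿ → ℝ satisfy: Ω_j(λy) = Ω_j(y) for all λ > 0 and y ∈ ℝⁿ; |Ω_j(ξ) − Ω_j(η)| ≤ C₀|ξ/|ξ| − η/|η||^β for some 0 < β < 1 and C₀ > 0; and ∫_{S^{n−1}} Ω_j dσ = 0. If f₁,…,f_m ∈ BMO(ℝⁿ) and the separated multilinear Marcinkiewicz integral μ̃(f⃗)(x₀) < ∞ for some point x₀ ∈ ℝⁿ, then μ̃(f⃗)(x) < ∞ for almost every x ∈ ℝⁿ, and there is C > 0 independent of f⃗ such that ‖μ̃(f⃗)‖_{BMO} ≤ C ∏_{j=1}^m ‖f_j‖_{BMO}. -/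

import Mathlib

open MeasureTheory Metric ENNReal

noncomputable def ballAvg (n : ℕ) (f : EuclideanSpace ℝ (Fin n) → ℝ)
    (c : EuclideanSpace ℝ (Fin n)) (r : ℝ) : ℝ :=
  (volume (closedBall c r)).toReal⁻¹ * ∫ y in closedBall c r, f y

noncomputable def bmoNorm (n : ℕ) (f : EuclideanSpace ℝ (Fin n) → ℝ) : ℝ≥0∞ :=
  ⨆ (c : EuclideanSpace ℝ (Fin n)) (r : ℝ) (_ : 0 < r),
    ENNReal.ofReal ((volume (closedBall c r)).toReal⁻¹ *
      ∫ y in closedBall c r, |f y - ballAvg n f c r|)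

noncomputable def campanatoNorm (n : ℕ) (α p : ℝ) (f : EuclideanSpace ℝ (Fin n) → ℝ) : ℝ≥0∞ :=
  ⨆ (c : EuclideanSpace ℝ (Fin n)) (r : ℝ) (_ : 0 < r),
    ENNReal.ofReal ((volume (closedBall c r)).toReal ^ (-(α / n)) *
      ((volume (closedBall c r)).toReal⁻¹ *
        ∫ y in closedBall c r, |f y - ballAvg n f c r| ^ p) ^ (1 / p))

noncomputable def campanato1Norm (n : ℕ) (α : ℝ) (f : EuclideanSpace ℝ (Fin n) → ℝ) : ℝ≥0∞ :=
  ⨆ (c : EuclideanSpace ℝ (Fin n)) (r : ℝ) (_ : 0 < r),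
    ENNReal.ofReal ((volume (closedBall c r)).toReal ^ (-(α / n)) *
      ((volume (closedBall c r)).toReal⁻¹ *
        ∫ y in closedBall c r, |f y - ballAvg n f c r|))

noncomputable def lipNorm (n : ℕ) (γ : ℝ) (f : EuclideanSpace ℝ (Fin n) → ℝ) : ℝ≥0∞ :=
  ⨆ (x : EuclideanSpace ℝ (Fin n)) (y : EuclideanSpace ℝ (Fin n)) (_ : x ≠ y),
    ENNReal.ofReal (|f x - f y| / ‖x - y‖ ^ γ)

noncomputable def sFt (n m : ℕ) (Ω : Fin m → EuclideanSpace ℝ (Fin n) → ℝ)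
    (f : Fin m → EuclideanSpace ℝ (Fin n) → ℝ) (t : ℝ) (x : EuclideanSpace ℝ (Fin n)) : ℝ :=
  t ^ (-(m : ℝ)) * ∏ j, ∫ y in closedBall (0 : EuclideanSpace ℝ (Fin n)) t,
    Ω j y / ‖y‖ ^ ((n : ℝ) - 1) * f j (x - y)

noncomputable def smarc (n m : ℕ) (Ω : Fin m → EuclideanSpace ℝ (Fin n) → ℝ)
    (f : Fin m → EuclideanSpace ℝ (Fin n) → ℝ) (x : EuclideanSpace ℝ (Fin n)) : ℝ≥0∞ :=
  (∫⁻ t in Set.Ioi (0 : ℝ), ENNReal.ofReal ((sFt n m Ω f t x) ^ 2 / t)) ^ (1 / 2 : ℝ)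


lemma vol_closedBall_mul (n : ℕ) (x y : EuclideanSpace ℝ (Fin n)) {k s : ℝ} (hk : 0 ≤ k)
    (hs : 0 ≤ s) :
    volume (closedBall x (k * s)) = ENNReal.ofReal (k ^ n) * volume (closedBall y s) := by
  rw [Measure.addHaar_closedBall_mul volume x hk hs, finrank_euclideanSpace, Fintype.card_fin,
    Measure.addHaar_closedBall_center volume y s]

lemma vol_pos (n : ℕ) (x : EuclideanSpace ℝ (Fin n)) {s : ℝ} (hs : 0 < s) :
    volume (closedBall x s) ≠ 0 := (measure_closedBall_pos volume x hs).ne'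

lemma vol_fin (n : ℕ) (x : EuclideanSpace ℝ (Fin n)) (s : ℝ) :
    volume (closedBall x s) ≠ ⊤ := measure_closedBall_lt_top.ne

lemma cz_cover (n : ℕ) (g : EuclideanSpace ℝ (Fin n) → ℝ≥0∞) (hg : AEMeasurable g volume)
    (c : EuclideanSpace ℝ (Fin n)) {r : ℝ} (hr : 0 < r) (l : ℝ≥0∞) (hl : l ≠ ⊤)
    (h_intg : ∫⁻ y in closedBall c (2 * r), g y ≤ l * volume (closedBall c r)) :
    ∃ (u : Set (EuclideanSpace ℝ (Fin n))) (ρ : EuclideanSpace ℝ (Fin n) → ℝ), u.Countable ∧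
      (u.PairwiseDisjoint fun x => closedBall x (ρ x)) ∧
      (∀ x ∈ u, 0 < ρ x ∧ closedBall x (ρ x) ⊆ closedBall c (2 * r) ∧
        l * volume (closedBall x (ρ x)) ≤ ∫⁻ y in closedBall x (ρ x), g y ∧
        ∫⁻ y in closedBall x (5 * ρ x), g y ≤ l * volume (closedBall x (5 * ρ x))) ∧
      ∀ᵐ y, y ∈ closedBall c r → l < g y → y ∈ ⋃ x ∈ u, closedBall x (5 * ρ x) := by
  set G : EuclideanSpace ℝ (Fin n) → ℝ≥0∞ := (closedBall c (2 * r)).indicator g with hG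
  have hGm : AEMeasurable G volume := hg.indicator measurableSet_closedBall
  have hGi : ∫⁻ y, G y ≠ ⊤ := by
    rw [hG, lintegral_indicator measurableSet_closedBall]
    exact ne_top_of_le_ne_top (ENNReal.mul_ne_top hl (vol_fin n c r)) h_intg
  have hae := (Besicovitch.vitaliFamily (volume : Measure (EuclideanSpace ℝ (Fin n)))).ae_tendsto_lintegral_div
    hGm hGi
  have hsub : ∀ x ∈ closedBall c r, ∀ s ≤ r, closedBall x s ⊆ closedBall c (2 * r) := by
    intro x hx s hs
    apply closedBall_subset_closedBall'
    have := mem_closedBall.1 hx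
    linarith
  have hIG : ∀ x ∈ closedBall c r, ∀ s ≤ r, ∫⁻ y in closedBall x s, G y =
      ∫⁻ y in closedBall x s, g y := by
    intro x hx s hs
    apply setLIntegral_congr_fun measurableSet_closedBall
    intro y hy
    simp [hG, Set.indicator_of_mem (hsub x hx s hs hy)]
  set S : Set (EuclideanSpace ℝ (Fin n)) := {x | x ∈ closedBall c r ∧ l < g x ∧
    Filter.Tendsto (fun a => (∫⁻ y in a, G y) / volume a)
      ((Besicovitch.vitaliFamily (volume : Measure (EuclideanSpace ℝ (Fin n)))).filterAt x)
      (nhds (G x))} with hS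
  have key : ∀ x ∈ S, ∃ ρ : ℝ, 0 < ρ ∧ 5 * ρ ≤ r ∧
      l * volume (closedBall x ρ) ≤ ∫⁻ y in closedBall x ρ, g y ∧
        ∫⁻ y in closedBall x (5 * ρ), g y ≤ l * volume (closedBall x (5 * ρ)) := by
    rintro x ⟨hx, hlx, ht⟩
    have h1 : Filter.Tendsto (fun j : ℕ => r * (1/5 : ℝ) ^ j) Filter.atTop
        (nhdsWithin 0 (Set.Ioi 0)) := by
      rw [tendsto_nhdsWithin_iff]
      constructor
      · have := (tendsto_pow_atTop_nhds_zero_of_lt_one (r := (1/5 : ℝ)) (by norm_num) (by norm_num)).const_mul r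
        simpa using this
      · filter_upwards with j
        simp only [Set.mem_Ioi]; positivity
    have h2 := ht.comp ((Besicovitch.tendsto_filterAt volume x).comp h1)
    have hGx : l < G x := by
      rw [hG, Set.indicator_of_mem (hsub x hx 0 hr.le (by simp))]; exact hlx
    have h3 := h2.eventually (lt_mem_nhds hGx)
    have hle : ∀ j : ℕ, r * (1/5 : ℝ) ^ j ≤ r := fun j =>
      mul_le_of_le_one_right hr.le (pow_le_one₀ (by norm_num) (by norm_num))
    have hex : ∃ j : ℕ, l * volume (closedBall x (r * (1/5 : ℝ) ^ j)) <
        ∫⁻ y in closedBall x (r * (1/5 : ℝ) ^ j), g y := by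
      obtain ⟨j, hj⟩ := h3.exists
      refine ⟨j, ?_⟩
      simp only [Function.comp] at hj
      rw [hIG x hx _ (hle j)] at hj
      rwa [ENNReal.lt_div_iff_mul_lt (Or.inl (vol_pos n x (by positivity)))
        (Or.inl (vol_fin n x _))] at hj
    classical
    have hj := Nat.find_spec hex
    have hmin := fun k => Nat.find_min (m := k) hex
    set j := Nat.find hex
    have hj0 : j ≠ 0 := by
      intro h0
      rw [h0] at hj
      simp only [pow_zero, mul_one] at hj
      have : ∫⁻ y in closedBall x r, g y ≤ l * volume (closedBall c r) :=
        (lintegral_mono_set (hsub x hx r le_rfl)).trans h_intg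
      rw [Measure.addHaar_closedBall_center volume c r,
        ← Measure.addHaar_closedBall_center volume x r] at this
      exact absurd hj (not_lt.2 this)
    obtain ⟨k, hk⟩ := Nat.exists_eq_succ_of_ne_zero hj0
    have h5 : 5 * (r * (1/5 : ℝ) ^ j) = r * (1/5 : ℝ) ^ k := by
      rw [hk, pow_succ]; ring
    refine ⟨r * (1/5 : ℝ) ^ j, by positivity, ?_, hj.le, ?_⟩
    · rw [h5]; exact hle k
    · rw [h5]; exact not_lt.1 (hmin k (by omega))
  choose! ρ hρ using key
  obtain ⟨u, huS, hdis, hcov⟩ := Vitali.exists_disjoint_subfamily_covering_enlargement_closedBall S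
    (fun x => x) ρ r (fun x hx => by have := hρ x hx; linarith) 5 (by norm_num)
  refine ⟨u, ρ, ?_, hdis, ?_, ?_⟩
  · apply hdis.countable_of_nonempty_interior
    intro x hx
    exact (nonempty_ball.2 (hρ x (huS hx)).1).mono ball_subset_interior_closedBall
  · intro x hx
    have h := hρ x (huS hx)
    exact ⟨h.1, hsub x (huS hx).1 _ (by linarith), h.2.2⟩
  · filter_upwards [hae] with y hy hyc hly
    have hyS : y ∈ S := ⟨hyc, hly, hy⟩
    obtain ⟨b, hb, hsb⟩ := hcov y hyS
    exact Set.mem_biUnion hb (hsb (mem_closedBall_self (hρ y hyS).1.le))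

lemma add_pow_le_two (x y : ℝ≥0∞) (p : ℕ) : (x + y) ^ p ≤ 2 ^ p * (x ^ p + y ^ p) := by
  rcases le_total x y with h | h
  · calc (x + y) ^ p ≤ (2 * y) ^ p := by gcongr; rw [two_mul]; gcongr
      _ = 2 ^ p * y ^ p := mul_pow _ _ _
      _ ≤ _ := by gcongr; exact le_add_self
  · calc (x + y) ^ p ≤ (2 * x) ^ p := by gcongr; rw [two_mul]; gcongr
      _ = 2 ^ p * x ^ p := mul_pow _ _ _
      _ ≤ _ := by gcongr; exact le_self_add

lemma const_diff (n : ℕ) (f : EuclideanSpace ℝ (Fin n) → ℝ) (hf : AEMeasurable f volume)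
    (s : Set (EuclideanSpace ℝ (Fin n))) (a b : ℝ) :
    ‖a - b‖ₑ * volume s ≤ (∫⁻ y in s, ‖f y - a‖ₑ) + ∫⁻ y in s, ‖f y - b‖ₑ := by
  rw [← lintegral_add_left' (by fun_prop), ← setLIntegral_const]
  apply lintegral_mono
  intro y
  have : a - b = -(f y - a) + (f y - b) := by ring
  calc ‖a - b‖ₑ = ‖-(f y - a) + (f y - b)‖ₑ := by rw [← this]
    _ ≤ _ := (enorm_add_le _ _).trans (by rw [enorm_neg])

lemma pow_shift (n : ℕ) (f : EuclideanSpace ℝ (Fin n) → ℝ)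
    (s : Set (EuclideanSpace ℝ (Fin n))) (a b : ℝ) (p : ℕ) (D : ℝ≥0∞) (hD : ‖a - b‖ₑ ≤ D) :
    ∫⁻ y in s, ‖f y - b‖ₑ ^ p ≤ 2 ^ p * ((∫⁻ y in s, ‖f y - a‖ₑ ^ p) + D ^ p * volume s) := by
  calc ∫⁻ y in s, ‖f y - b‖ₑ ^ p ≤ ∫⁻ y in s, 2 ^ p * (‖f y - a‖ₑ ^ p + D ^ p) := by
        apply lintegral_mono
        intro y
        refine le_trans ?_ (add_pow_le_two _ _ _)
        simp only
        gcongr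
        have : f y - b = (f y - a) + (a - b) := by ring
        rw [this]
        exact (enorm_add_le _ _).trans (by gcongr)
    _ = _ := by
        rw [lintegral_const_mul' _ _ (by simp), lintegral_add_right _ (by fun_prop),
          setLIntegral_const]

def OscBd (n : ℕ) (f : EuclideanSpace ℝ (Fin n) → ℝ) (a : EuclideanSpace ℝ (Fin n) → ℝ → ℝ)
    (p : ℕ) (N : ℝ≥0∞) : Prop :=
  ∀ c r, 0 < r → ∫⁻ y in closedBall c r, ‖f y - a c r‖ₑ ^ p ≤ N * volume (closedBall c r)

lemma jn_step (n p : ℕ) (f : EuclideanSpace ℝ (Fin n) → ℝ) (hf : AEMeasurable f volume)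
    (a : EuclideanSpace ℝ (Fin n) → ℝ → ℝ) (N : ℝ≥0∞) (hN0 : N ≠ 0) (hN : N ≠ ⊤)
    (h1 : OscBd n f a 1 N) (M : ℝ≥0∞) (hM : OscBd n f a p M) (L : ℝ≥0∞)
    (hL : L = 2 * 4 ^ p * 10 ^ n * N) :
    OscBd n f a p (3 * 4 ^ p * L ^ p + M / 2) := by
  intro c r hr
  have h1' : ∀ c r, 0 < r → ∫⁻ y in closedBall c r, ‖f y - a c r‖ₑ ≤ N * volume (closedBall c r) := by
    intro c r hr; simpa using h1 c r hr
  have hLt : L ≠ ⊤ := by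
    rw [hL]; exact ENNReal.mul_ne_top (by finiteness) hN
  have hL0 : L ≠ 0 := by rw [hL]; simp [hN0]
  have hNL : 2 ^ n * N ≤ L := by
    rw [hL]; gcongr
    calc (2:ℝ≥0∞) ^ n ≤ 10 ^ n := by gcongr; norm_num
      _ = 1 * 1 * 10 ^ n := by simp
      _ ≤ _ := by gcongr; norm_num; exact one_le_pow₀ (by norm_num)
  have hNL1 : N ≤ L := le_trans (le_mul_of_one_le_left (by simp) (one_le_pow₀ (by norm_num))) hNL
  set B := closedBall c r with hB
  set b := a c (2 * r) with hb
  have hv2 : volume (closedBall c (2 * r)) = 2 ^ n * volume B := by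
    rw [vol_closedBall_mul n c c (by norm_num) hr.le, ENNReal.ofReal_pow (by norm_num)]; simp [hB]
  have hi2 : ∫⁻ y in closedBall c (2 * r), ‖f y - b‖ₑ ≤ 2 ^ n * N * volume B := by
    refine (h1' c (2 * r) (by positivity)).trans ?_
    rw [hv2]; apply le_of_eq; ring
  obtain ⟨u, ρ, huc, hdis, hu, hcov⟩ := cz_cover n (fun y => ‖f y - b‖ₑ) (by fun_prop) c hr L hLt
    (hi2.trans (by gcongr))
  have hsum : 2 * 4 ^ p * 5 ^ n * ∑' x : u, volume (closedBall (x : EuclideanSpace ℝ (Fin n)) (ρ x)) ≤ volume B := by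
    have e1 : L * ∑' x : u, volume (closedBall (x : EuclideanSpace ℝ (Fin n)) (ρ x)) ≤ 2 ^ n * N * volume B := by
      rw [← ENNReal.tsum_mul_left]
      calc _ ≤ ∑' x : u, ∫⁻ y in closedBall (x : EuclideanSpace ℝ (Fin n)) (ρ x), ‖f y - b‖ₑ :=
            ENNReal.tsum_le_tsum fun x => (hu x x.2).2.2.1
        _ = ∫⁻ y in ⋃ x ∈ u, closedBall x (ρ x), ‖f y - b‖ₑ :=
            (lintegral_biUnion huc (fun _ _ => measurableSet_closedBall) hdis _).symm
        _ ≤ ∫⁻ y in closedBall c (2 * r), ‖f y - b‖ₑ :=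
            lintegral_mono_set (Set.iUnion₂_subset fun x hx => (hu x hx).2.1)
        _ ≤ _ := hi2
    have e2 : (10 : ℝ≥0∞) ^ n = 2 ^ n * 5 ^ n := by rw [← mul_pow]; norm_num
    rw [hL, e2] at e1
    have hne : (2:ℝ≥0∞) ^ n * N ≠ 0 := by simp [hN0]
    have hnt : (2:ℝ≥0∞) ^ n * N ≠ ⊤ := ENNReal.mul_ne_top (by finiteness) hN
    rw [← ENNReal.mul_le_mul_iff_right hne hnt]
    refine le_trans (le_of_eq ?_) e1
    ring
  have hball : ∀ x ∈ u, ∫⁻ y in closedBall x (5 * ρ x), ‖f y - b‖ₑ ^ p ≤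
      2 ^ p * (M + (2 * L) ^ p) * 5 ^ n * volume (closedBall x (ρ x)) := by
    intro x hx
    obtain ⟨hρ, -, -, h5⟩ := hu x hx
    have hv5 : volume (closedBall x (5 * ρ x)) = 5 ^ n * volume (closedBall x (ρ x)) := by
      rw [vol_closedBall_mul n x x (by norm_num) hρ.le, ENNReal.ofReal_pow (by norm_num)]; simp
    have hD : ‖a x (5 * ρ x) - b‖ₑ ≤ 2 * L := by
      have := const_diff n f hf (closedBall x (5 * ρ x)) (a x (5 * ρ x)) b
      have h6 := this.trans (add_le_add (h1' x (5 * ρ x) (by positivity)) h5)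
      rw [← add_mul] at h6
      rw [ENNReal.mul_le_mul_iff_left (vol_pos n x (by positivity)) (vol_fin n x _)] at h6
      refine h6.trans ?_
      rw [two_mul]; gcongr
    refine (pow_shift n f _ (a x (5 * ρ x)) b p _ hD).trans ?_
    calc _ ≤ 2 ^ p * (M * volume (closedBall x (5 * ρ x)) + (2 * L) ^ p * volume (closedBall x (5 * ρ x))) := by
          gcongr; exact hM x _ (by positivity)
      _ = _ := by rw [hv5]; ring
  have hmain : ∫⁻ y in B, ‖f y - b‖ₑ ^ p ≤ L ^ p * volume B +
      2 ^ p * (M + (2 * L) ^ p) * 5 ^ n * ∑' x : u, volume (closedBall (x : EuclideanSpace ℝ (Fin n)) (ρ x)) := by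
    set U := ⋃ x ∈ u, closedBall x (5 * ρ x) with hU
    have hUm : MeasurableSet U := MeasurableSet.biUnion huc fun _ _ => measurableSet_closedBall
    calc ∫⁻ y in B, ‖f y - b‖ₑ ^ p
        ≤ ∫⁻ y in B, (L ^ p + U.indicator (fun y => ‖f y - b‖ₑ ^ p) y) := by
          apply lintegral_mono_ae
          filter_upwards [ae_restrict_of_ae hcov, ae_restrict_mem measurableSet_closedBall] with y hy hyB
          by_cases hyU : y ∈ U
          · rw [Set.indicator_of_mem hyU]; exact le_add_self
          · have : ¬ L < ‖f y - b‖ₑ := fun h => hyU (hy hyB h)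
            refine le_trans ?_ le_self_add
            gcongr
            exact not_lt.1 this
      _ = L ^ p * volume B + ∫⁻ y in B, U.indicator (fun y => ‖f y - b‖ₑ ^ p) y := by
          rw [lintegral_add_left (by fun_prop), setLIntegral_const]
      _ ≤ L ^ p * volume B + ∫⁻ y in U, ‖f y - b‖ₑ ^ p := by
          refine add_le_add le_rfl ?_
          rw [← lintegral_indicator hUm]
          exact setLIntegral_le_lintegral _ _
      _ ≤ L ^ p * volume B + ∑' x : u, ∫⁻ y in closedBall (x : EuclideanSpace ℝ (Fin n)) (5 * ρ x), ‖f y - b‖ₑ ^ p := by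
          gcongr
          rw [hU, Set.biUnion_eq_iUnion]
          have := huc.to_subtype
          exact lintegral_iUnion_le _ _
      _ ≤ _ := by
          gcongr
          rw [← ENNReal.tsum_mul_left]
          exact ENNReal.tsum_le_tsum fun x => hball x x.2
  have hD2 : ‖b - a c r‖ₑ ≤ 2 * L := by
    have := const_diff n f hf B b (a c r)
    have h6 := this.trans (add_le_add ((lintegral_mono_set
      (closedBall_subset_closedBall (by linarith))).trans hi2) (h1' c r hr))
    rw [← add_mul] at h6
    rw [ENNReal.mul_le_mul_iff_left (vol_pos n c (by positivity)) (vol_fin n c _)] at h6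
    refine h6.trans ?_
    rw [two_mul]; gcongr
  refine (pow_shift n f B b (a c r) p _ hD2).trans ?_
  set T := ∑' x : u, volume (closedBall (x : EuclideanSpace ℝ (Fin n)) (ρ x)) with hT
  have h24 : (2:ℝ≥0∞) ^ p * 2 ^ p = 4 ^ p := by rw [← mul_pow]; norm_num
  have hhalf : (2:ℝ≥0∞)⁻¹ * 2 = 1 := ENNReal.inv_mul_cancel (by norm_num) (by norm_num)
  calc 2 ^ p * ((∫⁻ y in B, ‖f y - b‖ₑ ^ p) + (2 * L) ^ p * volume B)
      ≤ 2 ^ p * ((L ^ p * volume B + 2 ^ p * (M + (2 * L) ^ p) * 5 ^ n * T) + (2 * L) ^ p * volume B) := by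
        gcongr
    _ = (2 ^ p * L ^ p + 4 ^ p * L ^ p) * volume B + 2⁻¹ * (M + 2 ^ p * L ^ p) * (2 * 4 ^ p * 5 ^ n * T) := by
        rw [mul_pow, ← h24]
        have : ∀ X : ℝ≥0∞, 2⁻¹ * X * (2 * (2 ^ p * 2 ^ p) * 5 ^ n * T) = (2⁻¹ * 2) * (X * ((2 ^ p * 2 ^ p) * 5 ^ n * T)) := by
          intro X; ring
        rw [this, hhalf]
        ring
    _ ≤ (2 ^ p * L ^ p + 4 ^ p * L ^ p) * volume B + 2⁻¹ * (M + 2 ^ p * L ^ p) * volume B := by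
        gcongr
    _ = ((2 ^ p * L ^ p + 4 ^ p * L ^ p + 2⁻¹ * (2 ^ p * L ^ p)) + M / 2) * volume B := by
        rw [div_eq_mul_inv]; ring
    _ ≤ _ := by
        gcongr
        have h3 : (3 : ℝ≥0∞) * 4 ^ p * L ^ p = 4 ^ p * L ^ p + 4 ^ p * L ^ p + 1 * (4 ^ p * L ^ p) := by ring
        rw [h3]
        gcongr
        · norm_num
        · exact ENNReal.inv_le_one.2 (by norm_num)
        · norm_num


lemma jn_bounded (n p : ℕ) (f : EuclideanSpace ℝ (Fin n) → ℝ) (hf : AEMeasurable f volume)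
    (a : EuclideanSpace ℝ (Fin n) → ℝ → ℝ) (N : ℝ≥0∞) (hN0 : N ≠ 0) (hN : N ≠ ⊤)
    (h1 : OscBd n f a 1 N) (M₀ : ℝ≥0∞) (hM₀ : M₀ ≠ ⊤) (hM : OscBd n f a p M₀) :
    OscBd n f a p (2 * (3 * 4 ^ p * (2 * 4 ^ p * 10 ^ n * N) ^ p)) := by
  set S : Set ℝ≥0∞ := {M | OscBd n f a p M} with hS
  set M := sInf S with hMdef
  have hMS : OscBd n f a p M := by
    intro c r hr
    rw [← ENNReal.div_le_iff (vol_pos n c hr) (vol_fin n c r)]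
    apply le_sInf
    intro M' hM'
    rw [ENNReal.div_le_iff (vol_pos n c hr) (vol_fin n c r)]
    exact hM' c r hr
  have hMt : M ≠ ⊤ := ne_top_of_le_ne_top hM₀ (sInf_le hM)
  have h2 := jn_step n p f hf a N hN0 hN h1 M hMS _ rfl
  set X := 3 * 4 ^ p * (2 * 4 ^ p * 10 ^ n * N) ^ p with hX
  have h3 : M ≤ X + M / 2 := sInf_le h2
  have h4 : M / 2 ≤ X := by
    have : M / 2 + M / 2 ≤ X + M / 2 := by rw [ENNReal.add_halves]; exact h3
    exact (ENNReal.add_le_add_iff_right (ENNReal.div_ne_top hMt (by norm_num))).1 this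
  have h5 : M ≤ 2 * X := by
    rw [← ENNReal.add_halves M, two_mul]; gcongr
  intro c r hr
  exact (hMS c r hr).trans (by gcongr)

noncomputable def clampk (k : ℕ) (x : ℝ) : ℝ := max (-(k:ℝ)) (min k x)

lemma clampk_lip (k : ℕ) (x y : ℝ) : |clampk k x - clampk k y| ≤ |x - y| := by
  unfold clampk
  calc _ ≤ |min (k:ℝ) x - min (k:ℝ) y| := abs_max_sub_max_le_max _ _ _ _ |>.trans (by simp)
    _ ≤ _ := (abs_min_sub_min_le_max _ _ _ _).trans (by simp)

lemma clampk_abs (k : ℕ) (x : ℝ) : |clampk k x| ≤ k := by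
  unfold clampk
  have : (0:ℝ) ≤ k := by positivity
  rw [abs_le]
  exact ⟨le_max_left _ _, max_le (by linarith) (min_le_left _ _)⟩

lemma clampk_eq (k : ℕ) (x : ℝ) (h : |x| ≤ k) : clampk k x = x := by
  unfold clampk
  rw [abs_le] at h
  rw [min_eq_right h.2, max_eq_right h.1]

lemma clampk_meas (k : ℕ) : Measurable (clampk k) := by
  unfold clampk; fun_prop

theorem jn (n p : ℕ) (hp : p ≠ 0) : ∃ C : ℝ≥0∞, C ≠ ⊤ ∧ ∀ (f : EuclideanSpace ℝ (Fin n) → ℝ)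
    (_ : AEMeasurable f volume) (a : EuclideanSpace ℝ (Fin n) → ℝ → ℝ) (N : ℝ≥0∞), N ≠ ⊤ →
    OscBd n f a 1 N → OscBd n f a p (C * N ^ p) := by
  refine ⟨2 * (3 * 4 ^ p * (2 * 4 ^ p * 10 ^ n) ^ p), by finiteness, ?_⟩
  intro f hf a N hN h1 c r hr
  by_cases hN0 : N = 0
  · have h := h1 c r hr
    simp only [hN0, zero_mul, pow_one, nonpos_iff_eq_zero] at h
    rw [lintegral_eq_zero_iff' (by fun_prop)] at h
    refine le_trans (le_of_eq ?_) (zero_le (a := _))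
    rw [lintegral_eq_zero_iff' (by fun_prop)]
    filter_upwards [h] with y hy
    simp only [Pi.zero_apply] at hy ⊢
    rw [hy, zero_pow hp]
  set a0 := a c r with ha0
  have hk : ∀ k : ℕ, ∫⁻ y in closedBall c r, ‖clampk k (f y - a0)‖ₑ ^ p ≤
      2 * (3 * 4 ^ p * (2 * 4 ^ p * 10 ^ n) ^ p) * N ^ p * volume (closedBall c r) := by
    intro k
    have hb := jn_bounded n p (fun y => clampk k (f y - a0))
      ((clampk_meas k).comp_aemeasurable (by fun_prop)) (fun c r => clampk k (a c r - a0)) N hN0 hN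
      (by
        intro c r hr
        refine le_trans ?_ (h1 c r hr)
        apply lintegral_mono
        intro y
        simp only [pow_one]
        rw [← ofReal_norm, ← ofReal_norm]
        apply ENNReal.ofReal_le_ofReal
        have := clampk_lip k (f y - a0) (a c r - a0)
        simpa using this)
      ((ENNReal.ofReal (2 * k)) ^ p) (by finiteness)
      (by
        intro c r hr
        rw [← setLIntegral_const]
        apply lintegral_mono
        intro y
        simp only
        gcongr
        rw [← ofReal_norm]
        apply ENNReal.ofReal_le_ofReal
        refine (norm_sub_le _ _).trans ?_
        have h1 := clampk_abs k (f y - a0)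
        have h2 := clampk_abs k (a c r - a0)
        simp only [Real.norm_eq_abs]
        linarith) c r hr
    have hz : clampk k (a c r - a0) = 0 := by
      rw [clampk_eq] <;> simp [ha0]
    simp only [hz, sub_zero] at hb
    refine hb.trans (le_of_eq ?_)
    rw [mul_pow _ N]; ring
  have hlim : ∀ y, Filter.Tendsto (fun k : ℕ => ‖clampk k (f y - a0)‖ₑ ^ p) Filter.atTop
      (nhds (‖f y - a0‖ₑ ^ p)) := by
    intro y
    apply tendsto_const_nhds.congr'
    filter_upwards [Filter.eventually_ge_atTop ⌈|f y - a0|⌉₊] with k hk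
    rw [clampk_eq]
    exact (Nat.le_ceil _).trans (by exact_mod_cast hk)
  calc ∫⁻ y in closedBall c r, ‖f y - a0‖ₑ ^ p
      = ∫⁻ y in closedBall c r, Filter.liminf (fun k : ℕ => ‖clampk k (f y - a0)‖ₑ ^ p) Filter.atTop := by
        congr 1; ext y; exact (hlim y).liminf_eq.symm
    _ ≤ Filter.liminf (fun k : ℕ => ∫⁻ y in closedBall c r, ‖clampk k (f y - a0)‖ₑ ^ p) Filter.atTop := by
        apply lintegral_liminf_le'
        intro k
        have := ((clampk_meas k).comp_aemeasurable (hf.sub_const a0)).restrict (s := closedBall c r)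
        exact (this.enorm).pow_const p
    _ ≤ _ := by
        apply Filter.liminf_le_of_le
        · exact ⟨0, by simp⟩
        · intro b hb
          obtain ⟨k, hk'⟩ := hb.exists
          exact hk'.trans (hk k)


section
open FourierTransform SchwartzMap

lemma fourier_L2_ae (n : ℕ) (h : EuclideanSpace ℝ (Fin n) → ℂ) (h1 : Integrable h volume)
    (h2 : MemLp h 2 volume) :
    ((𝓕 (h2.toLp h) : Lp ℂ 2 (volume : Measure (EuclideanSpace ℝ (Fin n)))) : EuclideanSpace ℝ (Fin n) → ℂ)
      =ᵐ[volume] 𝓕 h := by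
  have hc : Continuous (𝓕 h) :=
    VectorFourier.fourierIntegral_continuous Real.continuous_fourierChar
      (by exact continuous_inner) h1
  apply ae_eq_of_integral_contDiff_smul_eq
  · exact (Lp.memLp _).locallyIntegrable (by norm_num)
  · exact hc.locallyIntegrable
  · intro g hg hgs
    have hg' : ContDiff ℝ ((⊤ : ℕ∞) : WithTop ℕ∞) (fun x => (g x : ℂ)) :=
      Complex.ofRealCLM.contDiff.comp hg
    have hgs' : HasCompactSupport (fun x => (g x : ℂ)) := hgs.comp_left (g := fun x : ℝ => (x:ℂ)) rfl
    let φ : 𝓢(EuclideanSpace ℝ (Fin n), ℂ) := hgs'.toSchwartzMap hg'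
    have e1 := congrArg (fun T => T φ) (Lp.fourier_toTemperedDistribution_eq (h2.toLp h))
    simp only [TemperedDistribution.fourier_apply, Lp.toTemperedDistribution_apply] at e1
    have e2 : ∫ ξ, (𝓕 (φ : EuclideanSpace ℝ (Fin n) → ℂ) ξ) • h ξ =
        ∫ x, (φ x) • (𝓕 h x) := by
      have := VectorFourier.integral_fourierIntegral_smul_eq_flip (L := innerₗ (EuclideanSpace ℝ (Fin n)))
        Real.continuous_fourierChar continuous_inner φ.integrable h1 (μ := volume) (ν := volume)
      simpa using! this
    have e3 : ∫ x, (𝓕 φ) x • (h2.toLp h) x = ∫ ξ, (𝓕 (φ : EuclideanSpace ℝ (Fin n) → ℂ) ξ) • h ξ := by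
      apply integral_congr_ae
      filter_upwards [h2.coeFn_toLp] with x hx
      rw [hx, SchwartzMap.fourier_coe]
    have e4 := e1.symm.trans (e3.trans e2)
    simpa [φ] using e4

lemma plancherel_L1L2 (n : ℕ) (h : EuclideanSpace ℝ (Fin n) → ℂ) (h1 : Integrable h volume)
    (h2 : MemLp h 2 volume) :
    ∫⁻ ξ, ‖𝓕 h ξ‖ₑ ^ 2 = ∫⁻ x, ‖h x‖ₑ ^ 2 := by
  have e := Lp.norm_fourier_eq (h2.toLp h)
  have e' : eLpNorm (𝓕 h) 2 volume = eLpNorm h 2 volume := by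
    rw [← eLpNorm_congr_ae (fourier_L2_ae n h h1 h2), ← eLpNorm_congr_ae h2.coeFn_toLp]
    rw [Lp.norm_def, Lp.norm_def] at e
    exact (ENNReal.toReal_eq_toReal_iff' (Lp.eLpNorm_ne_top _) (Lp.eLpNorm_ne_top _)).1 e
  rw [eLpNorm_eq_lintegral_rpow_enorm_toReal (by norm_num) (by norm_num),
    eLpNorm_eq_lintegral_rpow_enorm_toReal (by norm_num) (by norm_num)] at e'
  have := congrArg (fun x : ℝ≥0∞ => x ^ (2:ℝ)) e'
  simp only [← ENNReal.rpow_mul] at this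
  simpa using this
end


lemma tail_lint (T δ : ℝ) (hT : 0 < T) (hδ : 0 < δ) :
    ∫⁻ t in Set.Ioi T, ENNReal.ofReal ((T / t) ^ (2 * δ) / t) = ENNReal.ofReal (1 / (2 * δ)) := by
  have e : ∀ t ∈ Set.Ioi T, (T / t) ^ (2 * δ) / t = T ^ (2 * δ) * t ^ (-(2 * δ) - 1) := by
    intro t ht
    have ht0 : 0 < t := hT.trans ht
    rw [Real.div_rpow hT.le ht0.le, Real.rpow_sub ht0, Real.rpow_neg ht0.le, Real.rpow_one]
    field_simp
  rw [setLIntegral_congr_fun measurableSet_Ioi (fun t ht => by rw [e t ht])]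
  have hi : IntegrableOn (fun t : ℝ => T ^ (2 * δ) * t ^ (-(2 * δ) - 1)) (Set.Ioi T) :=
    (integrableOn_Ioi_rpow_of_lt (by linarith) hT).const_mul _
  rw [← ofReal_integral_eq_lintegral_ofReal hi]
  · congr 1
    rw [integral_const_mul, integral_Ioi_rpow_of_lt (by linarith) hT]
    have : -(2 * δ) - 1 + 1 = -(2 * δ) := by ring
    rw [this, Real.rpow_neg hT.le]
    have : T ^ (2 * δ) ≠ 0 := (Real.rpow_pos_of_pos hT _).ne'
    field_simp
  · filter_upwards [ae_restrict_mem measurableSet_Ioi] with t ht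
    have ht0 : 0 < t := hT.trans ht
    simp only [Pi.zero_apply]; positivity

section
open FourierTransform

lemma Khat_small (n : ℕ) (K : EuclideanSpace ℝ (Fin n) → ℝ) (hK : Integrable K volume)
    (hsupp : ∀ u, 1 < ‖u‖ → K u = 0) (h0 : ∫ u, K u = 0) (ζ : EuclideanSpace ℝ (Fin n)) :
    ‖𝓕 (fun u => (K u : ℂ)) ζ‖ ≤ 2 * Real.pi * (∫ u, |K u|) * ‖ζ‖ := by
  have hKc : Integrable (fun u => (K u : ℂ)) volume := hK.ofReal
  have h1 : Integrable (fun v => Real.fourierChar (-inner ℝ v ζ) • (K v : ℂ)) volume :=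
    (Real.fourierIntegral_convergent_iff ζ).2 hKc
  have e : 𝓕 (fun u => (K u : ℂ)) ζ =
      ∫ v, (Real.fourierChar (-inner ℝ v ζ) • (K v : ℂ) - (K v : ℂ)) := by
    rw [integral_sub h1 hKc, integral_complex_ofReal, h0]
    simp [Real.fourier_eq]
  rw [e]
  calc _ ≤ ∫ v, 2 * Real.pi * ‖ζ‖ * |K v| := by
        apply norm_integral_le_of_norm_le (hK.abs.const_mul _)
        filter_upwards with v
        by_cases hv : 1 < ‖v‖
        · simp [hsupp v hv]
        · rw [Circle.smul_def, smul_eq_mul, ← sub_one_mul, norm_mul, Complex.norm_real, Real.norm_eq_abs]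
          gcongr
          rw [Real.fourierChar_apply]
          have := Real.norm_exp_I_mul_ofReal_sub_one_le (x := 2 * Real.pi * (-inner ℝ v ζ))
          rw [mul_comm Complex.I] at this
          refine this.trans ?_
          rw [norm_mul, norm_neg, Real.norm_eq_abs (2 * Real.pi), abs_of_pos Real.two_pi_pos]
          gcongr
          refine (norm_inner_le_norm (𝕜 := ℝ) v ζ).trans ?_
          exact mul_le_of_le_one_left (norm_nonneg _) (not_lt.1 hv)
    _ = _ := by rw [integral_const_mul]; ring

lemma Khat_large (n : ℕ) (K : EuclideanSpace ℝ (Fin n) → ℝ) (hK : Integrable K volume)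
    (D δ : ℝ) (hD : 0 ≤ D) (hδ : 0 < δ)
    (hmod : ∀ η : EuclideanSpace ℝ (Fin n), ‖η‖ ≤ 1 →
      ∫⁻ u, ‖K (u - η) - K u‖ₑ ≤ ENNReal.ofReal (D * ‖η‖ ^ δ))
    (ζ : EuclideanSpace ℝ (Fin n)) (hζ : 1 ≤ ‖ζ‖) :
    ‖𝓕 (fun u => (K u : ℂ)) ζ‖ ≤ D * ‖ζ‖ ^ (-δ) := by
  have hKc : Integrable (fun u => (K u : ℂ)) volume := hK.ofReal
  have hz : ζ ≠ 0 := by intro h; simp [h] at hζ; linarith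
  have hzp : 0 < ‖ζ‖ := norm_pos_iff.2 hz
  rw [Real.fourier_eq, fourierIntegral_eq_half_sub_half_period_translate hz hKc]
  set η := -((1 / (2 * ‖ζ‖ ^ 2) : ℝ) • ζ) with hη
  have hnη : ‖η‖ = 1 / (2 * ‖ζ‖) := by
    rw [hη, norm_neg, norm_smul, Real.norm_eq_abs, abs_of_pos (by positivity)]
    field_simp
  have hη1 : ‖η‖ ≤ ‖ζ‖⁻¹ := by
    rw [hnη, one_div]; gcongr; linarith
  have hsh : Integrable (fun u => K (u - η)) volume := hK.comp_sub_right η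
  have h1 : ∫ u, ‖K (u - η) - K u‖ ≤ D * ‖η‖ ^ δ := by
    have hm : AEStronglyMeasurable (fun u => K (u - η) - K u) volume :=
      (hsh.sub hK).aestronglyMeasurable
    rw [integral_norm_eq_lintegral_enorm hm]
    apply ENNReal.toReal_le_of_le_ofReal (by positivity)
    exact hmod η (hη1.trans (inv_le_one_of_one_le₀ hζ))
  rw [norm_smul]
  calc _ ≤ 1 * ∫ u, ‖K (u - η) - K u‖ := by
        gcongr
        · norm_num
        · apply norm_integral_le_of_norm_le (hsh.sub hK).norm
          filter_upwards with v
          rw [Circle.norm_smul, ← Complex.ofReal_sub, Complex.norm_real, ← norm_neg, neg_sub]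
          simp [hη, sub_neg_eq_add]
    _ ≤ D * ‖η‖ ^ δ := by rw [one_mul]; exact h1
    _ ≤ D * (‖ζ‖⁻¹) ^ δ := by gcongr
    _ = _ := by rw [Real.rpow_neg hzp.le, Real.inv_rpow hzp.le]

lemma Khat_dt (n : ℕ) (K : EuclideanSpace ℝ (Fin n) → ℝ) (hK : Integrable K volume)
    (hsupp : ∀ u, 1 < ‖u‖ → K u = 0) (h0 : ∫ u, K u = 0)
    (D δ : ℝ) (hD : 0 ≤ D) (hδ : 0 < δ)
    (hmod : ∀ η : EuclideanSpace ℝ (Fin n), ‖η‖ ≤ 1 →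
      ∫⁻ u, ‖K (u - η) - K u‖ₑ ≤ ENNReal.ofReal (D * ‖η‖ ^ δ)) :
    ∃ C : ℝ≥0∞, C ≠ ⊤ ∧ ∀ ξ : EuclideanSpace ℝ (Fin n), ξ ≠ 0 →
      ∫⁻ t in Set.Ioi (0:ℝ), ‖𝓕 (fun u => (K u : ℂ)) (t • ξ)‖ₑ ^ 2 * ENNReal.ofReal (1 / t) ≤ C := by
  set A := 2 * Real.pi * (∫ u, |K u|) with hA
  have hA0 : 0 ≤ A := by
    have : 0 ≤ ∫ u, |K u| := integral_nonneg fun u => abs_nonneg _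
    positivity
  refine ⟨ENNReal.ofReal (A ^ 2) + ENNReal.ofReal (D ^ 2) * ENNReal.ofReal (1 / (2 * δ)), by finiteness, ?_⟩
  intro ξ hξ
  have hx : 0 < ‖ξ‖ := norm_pos_iff.2 hξ
  set T := ‖ξ‖⁻¹ with hT
  have hTp : 0 < T := by positivity
  have hsplit : Set.Ioi (0:ℝ) = Set.Ioc 0 T ∪ Set.Ioi T := (Set.Ioc_union_Ioi_eq_Ioi hTp.le).symm
  rw [hsplit]
  refine (lintegral_union_le _ _ _).trans ?_
  have hform : ∀ t : ℝ, 0 < t → ‖𝓕 (fun u => (K u : ℂ)) (t • ξ)‖ₑ ^ 2 * ENNReal.ofReal (1 / t) =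
      ENNReal.ofReal (‖𝓕 (fun u => (K u : ℂ)) (t • ξ)‖ ^ 2 / t) := by
    intro t ht
    rw [← ofReal_norm, ← ENNReal.ofReal_pow (norm_nonneg _), ← ENNReal.ofReal_mul (by positivity)]
    congr 1; ring
  gcongr
  · calc _ ≤ ∫⁻ t in Set.Ioc 0 T, ENNReal.ofReal (A ^ 2 * ‖ξ‖) := by
          apply setLIntegral_mono measurable_const
          intro t ht
          rw [hform t ht.1]
          apply ENNReal.ofReal_le_ofReal
          have h := Khat_small n K hK hsupp h0 (t • ξ)
          rw [← hA, norm_smul, Real.norm_eq_abs, abs_of_pos ht.1] at h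
          have ht0 := ht.1
          rw [div_le_iff₀ ht.1]
          calc _ ≤ (A * (t * ‖ξ‖)) ^ 2 := by gcongr
            _ = A ^ 2 * ‖ξ‖ * t * (t * ‖ξ‖) := by ring
            _ ≤ A ^ 2 * ‖ξ‖ * t * 1 := by
              gcongr
              calc t * ‖ξ‖ ≤ T * ‖ξ‖ := by gcongr; exact ht.2
                _ = 1 := by rw [hT]; field_simp
            _ = _ := by ring
      _ = ENNReal.ofReal (A ^ 2) := by
          rw [setLIntegral_const, Real.volume_Ioc, ← ENNReal.ofReal_mul (by positivity)]
          congr 1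
          rw [hT]; field_simp; ring
  · rw [← tail_lint T δ hTp hδ, ← lintegral_const_mul' _ _ (by finiteness)]
    apply setLIntegral_mono' measurableSet_Ioi
    intro t ht
    have ht0 : 0 < t := hTp.trans ht
    rw [hform t ht0, ← ENNReal.ofReal_mul (by positivity)]
    apply ENNReal.ofReal_le_ofReal
    have htx : 1 ≤ t * ‖ξ‖ := by
      calc 1 = T * ‖ξ‖ := by rw [hT]; field_simp
        _ ≤ _ := by gcongr; exact le_of_lt ht
    have h := Khat_large n K hK D δ hD hδ hmod (t • ξ) (by
      rwa [norm_smul, Real.norm_eq_abs, abs_of_pos ht0])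
    rw [norm_smul, Real.norm_eq_abs, abs_of_pos ht0] at h
    rw [← mul_div_assoc]
    gcongr
    have e : T / t = (t * ‖ξ‖)⁻¹ := by rw [hT]; field_simp
    calc _ ≤ (D * (t * ‖ξ‖) ^ (-δ)) ^ 2 := by gcongr
      _ = _ := by
        rw [e, mul_pow, Real.inv_rpow (by positivity), ← Real.rpow_neg (by positivity),
          ← Real.rpow_natCast ((t * ‖ξ‖) ^ (-δ)), ← Real.rpow_mul (by positivity)]
        congr 2; push_cast; ring
end


lemma lint_smul (n : ℕ) (φ : EuclideanSpace ℝ (Fin n) → ℝ≥0∞) {t : ℝ} (ht : 0 < t) :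
    ∫⁻ u, φ (t • u) = ENNReal.ofReal ((t ^ n)⁻¹) * ∫⁻ u, φ u := by
  have h := Measure.map_addHaar_smul (volume : Measure (EuclideanSpace ℝ (Fin n))) ht.ne'
  have e := lintegral_map_equiv (μ := volume) φ
    (Homeomorph.smulOfNeZero t ht.ne' : EuclideanSpace ℝ (Fin n) ≃ₜ _).toMeasurableEquiv
  have e2 : (fun x : EuclideanSpace ℝ (Fin n) => t • x) =
    ⇑(Homeomorph.smulOfNeZero t ht.ne' : EuclideanSpace ℝ (Fin n) ≃ₜ _).toMeasurableEquiv := rfl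
  rw [← e2, h, lintegral_smul_measure] at e
  rw [← e]
  simp only [finrank_euclideanSpace, Fintype.card_fin, smul_eq_mul]
  rw [abs_of_pos (by positivity)]

lemma cs_ker {α : Type*} [MeasurableSpace α] (μ : Measure α) (k h : α → ℝ≥0∞)
    (hk : AEMeasurable k μ) (hh : AEMeasurable h μ) :
    (∫⁻ u, k u * h u ∂μ) ^ 2 ≤ (∫⁻ u, k u ∂μ) * ∫⁻ u, k u * h u ^ 2 ∂μ := by
  have h1 := ENNReal.lintegral_mul_le_Lp_mul_Lq μ (p := 2) (q := 2) (Real.HolderConjugate.two_two)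
    (f := fun u => k u ^ (1/2:ℝ)) (g := fun u => k u ^ (1/2:ℝ) * h u) (hk.pow_const _)
    ((hk.pow_const _).mul hh)
  have e0 : ∀ a : ℝ≥0∞, a ^ (1/2:ℝ) * a ^ (1/2:ℝ) = a := by
    intro a
    rw [← ENNReal.rpow_add_of_nonneg _ _ (by norm_num) (by norm_num)]; norm_num
  have e1 : ∀ a : ℝ≥0∞, (a ^ (1/2:ℝ)) ^ (2:ℝ) = a := by
    intro a; rw [← ENNReal.rpow_mul]; norm_num
  simp only [Pi.mul_apply, ← mul_assoc, e0] at h1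
  simp only [ENNReal.mul_rpow_of_nonneg _ _ (by norm_num : (0:ℝ) ≤ 2), e1] at h1
  calc _ ≤ _ := pow_le_pow_left' h1 2
    _ = _ := by
      rw [mul_pow]
      simp only [← ENNReal.rpow_natCast, ← ENNReal.rpow_mul]
      norm_num

lemma T_meas (n : ℕ) (K g : EuclideanSpace ℝ (Fin n) → ℝ) (hK : Measurable K) (hg : Measurable g) :
    Measurable (fun p : ℝ × EuclideanSpace ℝ (Fin n) => ∫ u, K u * g (p.2 - p.1 • u)) := by
  have h : StronglyMeasurable (fun q : (ℝ × EuclideanSpace ℝ (Fin n)) × EuclideanSpace ℝ (Fin n) =>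
      K q.2 * g (q.1.2 - q.1.1 • q.2)) := by
    apply Measurable.stronglyMeasurable
    apply (hK.comp measurable_snd).mul
    apply hg.comp
    exact (measurable_fst.snd).sub ((measurable_fst.fst).smul measurable_snd)
  exact (h.integral_prod_right (ν := volume)).measurable

lemma enorm_ofReal_c (x : ℝ) : ‖(x : ℂ)‖ₑ = ‖x‖ₑ := by
  rw [← ofReal_norm, ← ofReal_norm, Complex.norm_real]

section
open FourierTransform
open scoped Convolution

lemma sq_fun (n : ℕ) (K : EuclideanSpace ℝ (Fin n) → ℝ) (hKm : Measurable K) (hK : Integrable K volume)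
    (hsupp : ∀ u, 1 < ‖u‖ → K u = 0) (h0 : ∫ u, K u = 0)
    (D δ : ℝ) (hD : 0 ≤ D) (hδ : 0 < δ)
    (hmod : ∀ η : EuclideanSpace ℝ (Fin n), ‖η‖ ≤ 1 →
      ∫⁻ u, ‖K (u - η) - K u‖ₑ ≤ ENNReal.ofReal (D * ‖η‖ ^ δ)) (hn : 1 ≤ n) :
    ∃ C : ℝ≥0∞, C ≠ ⊤ ∧ ∀ g : EuclideanSpace ℝ (Fin n) → ℝ, Measurable g → Integrable g volume →
      MemLp g 2 volume →
      ∫⁻ t in Set.Ioi (0:ℝ), (∫⁻ x, ‖∫ u, K u * g (x - t • u)‖ₑ ^ 2) * ENNReal.ofReal (1 / t)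
        ≤ C * ∫⁻ x, ‖g x‖ₑ ^ 2 := by
  obtain ⟨C, hC, hb⟩ := Khat_dt n K hK hsupp h0 D δ hD hδ hmod
  refine ⟨C, hC, fun g hgm hg1 hg2 => ?_⟩
  have hgc : Integrable (fun x => (g x : ℂ)) volume := hg1.ofReal
  have hgc2 : MemLp (fun x => (g x : ℂ)) 2 volume := hg2.ofReal
  have hg2' : ∫⁻ x, ‖g x‖ₑ ^ 2 < ⊤ := by
    have := lintegral_rpow_enorm_lt_top_of_eLpNorm_lt_top (p := 2) (by norm_num) (by norm_num) hg2.2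
    simpa using this
  have hKf : ∫⁻ x, ‖K x‖ₑ < ⊤ := hK.2
  have key : ∀ t ∈ Set.Ioi (0:ℝ), (∫⁻ x, ‖∫ u, K u * g (x - t • u)‖ₑ ^ 2) =
      ∫⁻ ξ, ‖𝓕 (fun u => (K u : ℂ)) (t • ξ)‖ₑ ^ 2 * ‖𝓕 (fun u => (g u : ℂ)) ξ‖ₑ ^ 2 := by
    intro t ht
    have ht0 : (0:ℝ) < t := ht
    let Kt : EuclideanSpace ℝ (Fin n) → ℂ := fun y => ((t ^ n)⁻¹ : ℝ) • (K (t⁻¹ • y) : ℂ)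
    have hKt : Integrable Kt volume := by
      exact ((hK.comp_smul (inv_ne_zero ht0.ne')).ofReal (𝕜 := ℂ)).smul ((t ^ n)⁻¹ : ℝ)
    have hcv : ∀ x, ((∫ u, K u * g (x - t • u) : ℝ) : ℂ) =
        (Kt ⋆[ContinuousLinearMap.mul ℂ ℂ, volume] (fun x => (g x : ℂ))) x := by
      intro x
      rw [convolution_def]
      have := Measure.integral_comp_inv_smul (volume : Measure (EuclideanSpace ℝ (Fin n)))
        (fun u => ((t ^ n)⁻¹ : ℝ) • ((K u : ℂ) * (g (x - t • u) : ℂ))) t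
      simp only [smul_inv_smul₀ ht0.ne'] at this
      simp only [ContinuousLinearMap.mul_apply', Kt, smul_mul_assoc]
      rw [this, integral_smul, smul_smul, finrank_euclideanSpace, Fintype.card_fin,
        abs_of_pos (by positivity), mul_inv_cancel₀ (by positivity), one_smul,
        ← integral_complex_ofReal]
      simp
    have hT1 : Integrable (fun x => ((∫ u, K u * g (x - t • u) : ℝ) : ℂ)) volume := by
      simp_rw [hcv]
      exact hKt.integrable_convolution _ hgc
    have hT2 : MemLp (fun x => ((∫ u, K u * g (x - t • u) : ℝ) : ℂ)) 2 volume := by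
      refine ⟨hT1.1, ?_⟩
      rw [eLpNorm_lt_top_iff_lintegral_rpow_enorm_lt_top (by norm_num) (by norm_num)]
      simp only [enorm_ofReal_c]
      have hpt : ∀ x, ‖∫ u, K u * g (x - t • u)‖ₑ ^ (2:ℝ≥0∞).toReal ≤
          (∫⁻ u, ‖K u‖ₑ) * ∫⁻ u, ‖K u‖ₑ * ‖g (x - t • u)‖ₑ ^ 2 := by
        intro x
        have hgx : Measurable fun u => g (x - t • u) := by
          apply hgm.comp; fun_prop
        refine le_trans ?_ (cs_ker volume (fun u => ‖K u‖ₑ) (fun u => ‖g (x - t • u)‖ₑ)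
          hKm.enorm.aemeasurable hgx.enorm.aemeasurable)
        simp only [ENNReal.toReal_ofNat, ENNReal.rpow_ofNat]
        gcongr
        refine (enorm_integral_le_lintegral_enorm _).trans_eq ?_
        simp [enorm_mul]
      refine (lintegral_mono hpt).trans_lt ?_
      rw [lintegral_const_mul' _ _ hKf.ne]
      apply ENNReal.mul_lt_top hKf
      have hm2 : Measurable (fun q : EuclideanSpace ℝ (Fin n) × EuclideanSpace ℝ (Fin n) =>
          ‖K q.2‖ₑ * ‖g (q.1 - t • q.2)‖ₑ ^ 2) := by
        apply (hKm.comp measurable_snd).enorm.mul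
        apply Measurable.pow_const
        apply Measurable.enorm
        apply hgm.comp
        fun_prop
      rw [lintegral_lintegral_swap hm2.aemeasurable]
      have : ∀ u, ∫⁻ x, ‖K u‖ₑ * ‖g (x - t • u)‖ₑ ^ 2 = ‖K u‖ₑ * ∫⁻ x, ‖g x‖ₑ ^ 2 := by
        intro u
        rw [lintegral_const_mul' _ _ (by finiteness),
          lintegral_sub_right_eq_self (fun x => ‖g x‖ₑ ^ 2)]
      simp_rw [this]
      rw [lintegral_mul_const' _ _ hg2'.ne]
      exact ENNReal.mul_lt_top hKf hg2'
    have hpl := plancherel_L1L2 n _ hT1 hT2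
    simp only [enorm_ofReal_c] at hpl
    rw [← hpl]
    congr 1
    ext ξ
    have hfe : (fun x => ((∫ u, K u * g (x - t • u) : ℝ) : ℂ)) =
      (Kt ⋆[ContinuousLinearMap.mul ℂ ℂ, volume] (fun x => (g x : ℂ))) := funext hcv
    rw [hfe, Real.fourier_mul_convolution_eq hKt hgc, enorm_mul, mul_pow]
    congr 3
    rw [Real.fourier_eq, Real.fourier_eq]
    have := Measure.integral_comp_inv_smul (volume : Measure (EuclideanSpace ℝ (Fin n)))
        (fun v => Real.fourierChar (-inner ℝ v (t • ξ)) • ((t ^ n)⁻¹ : ℝ) • (K v : ℂ)) t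
    have e3 : ∀ v : EuclideanSpace ℝ (Fin n), inner ℝ (t⁻¹ • v) (t • ξ) = inner ℝ v ξ := by
      intro v
      rw [real_inner_smul_left, real_inner_smul_right, ← mul_assoc, inv_mul_cancel₀ ht0.ne', one_mul]
    simp only [e3] at this
    simp only [Kt]
    rw [this]
    simp_rw [smul_comm _ ((t ^ n)⁻¹ : ℝ)]
    rw [integral_smul, smul_smul, finrank_euclideanSpace, Fintype.card_fin,
        abs_of_pos (by positivity), mul_inv_cancel₀ (by positivity), one_smul]
  have hpg := plancherel_L1L2 n _ hgc hgc2
  simp only [enorm_ofReal_c] at hpg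
  have hcK : Continuous (𝓕 (fun u => (K u : ℂ))) :=
    VectorFourier.fourierIntegral_continuous Real.continuous_fourierChar
      (by exact continuous_inner) hK.ofReal
  have hcg : Continuous (𝓕 (fun u => (g u : ℂ))) :=
    VectorFourier.fourierIntegral_continuous Real.continuous_fourierChar
      (by exact continuous_inner) hgc
  have hmj : Measurable (fun q : ℝ × EuclideanSpace ℝ (Fin n) =>
      ‖𝓕 (fun u => (K u : ℂ)) (q.1 • q.2)‖ₑ ^ 2 * ‖𝓕 (fun u => (g u : ℂ)) q.2‖ₑ ^ 2 *
        ENNReal.ofReal (1 / q.1)) := by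
    have h1 : Measurable (fun q : ℝ × EuclideanSpace ℝ (Fin n) => 𝓕 (fun u => (K u : ℂ)) (q.1 • q.2)) :=
      (hcK.comp continuous_smul).measurable
    have h2 : Measurable (fun q : ℝ × EuclideanSpace ℝ (Fin n) => 𝓕 (fun u => (g u : ℂ)) q.2) :=
      hcg.measurable.comp measurable_snd
    have h3 : Measurable (fun q : ℝ × EuclideanSpace ℝ (Fin n) => ENNReal.ofReal (1 / q.1)) := by
      fun_prop
    exact ((h1.enorm.pow_const 2).mul (h2.enorm.pow_const 2)).mul h3
  have : Nonempty (Fin n) := ⟨⟨0, hn⟩⟩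
  calc _ = ∫⁻ t in Set.Ioi (0:ℝ), ∫⁻ ξ, ‖𝓕 (fun u => (K u : ℂ)) (t • ξ)‖ₑ ^ 2 *
        ‖𝓕 (fun u => (g u : ℂ)) ξ‖ₑ ^ 2 * ENNReal.ofReal (1 / t) := by
        apply setLIntegral_congr_fun measurableSet_Ioi
        intro t ht
        simp only
        rw [key t ht, lintegral_mul_const' _ _ (by finiteness)]
    _ = ∫⁻ ξ, ∫⁻ t in Set.Ioi (0:ℝ), ‖𝓕 (fun u => (K u : ℂ)) (t • ξ)‖ₑ ^ 2 *
        ‖𝓕 (fun u => (g u : ℂ)) ξ‖ₑ ^ 2 * ENNReal.ofReal (1 / t) :=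
        lintegral_lintegral_swap hmj.aemeasurable
    _ ≤ ∫⁻ ξ, C * ‖𝓕 (fun u => (g u : ℂ)) ξ‖ₑ ^ 2 := by
        apply lintegral_mono_ae
        have hne : ∀ᵐ ξ : EuclideanSpace ℝ (Fin n), ξ ≠ 0 := by
          simp [ae_iff, measure_singleton]
        filter_upwards [hne] with ξ hξ
        refine le_trans (le_of_eq ?_) (mul_le_mul_left (hb ξ hξ) _)
        rw [← lintegral_mul_const' _ _ (by finiteness)]
        congr 1; ext t; ring
    _ = _ := by rw [lintegral_const_mul' _ _ hC, hpg]
end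


lemma rad_int (n : ℕ) (hn : 1 ≤ n) (s : ℝ) (hs : s < n) : ∃ C : ℝ≥0∞, C ≠ ⊤ ∧ ∀ a : ℝ, 0 < a →
    ∫⁻ u in closedBall (0 : EuclideanSpace ℝ (Fin n)) a, ENNReal.ofReal (‖u‖ ^ (-s)) ≤
      C * ENNReal.ofReal (a ^ ((n:ℝ) - s)) := by
  have hmeas : Measurable (fun u : EuclideanSpace ℝ (Fin n) => ‖u‖ ^ (-s)) := by fun_prop
  have hi : IntegrableOn (fun u : EuclideanSpace ℝ (Fin n) => ‖u‖ ^ (-s)) (ball 0 2) volume := by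
    refine integrableOn_ball_of_norm_le_rpow (C := 1) (α := s) (by simpa using hn) (by simpa using hs)
      ?_ hmeas.aestronglyMeasurable
    filter_upwards with x
    rw [one_mul, Real.norm_eq_abs, abs_of_nonneg (by positivity)]
  refine ⟨∫⁻ u in closedBall (0 : EuclideanSpace ℝ (Fin n)) 1, ENNReal.ofReal (‖u‖ ^ (-s)), ?_, ?_⟩
  · have h2 := (hi.mono_set (closedBall_subset_ball (by norm_num : (1:ℝ) < 2))).lintegral_lt_top
    exact h2.ne
  · intro a ha
    have h := lint_smul n ((closedBall (0 : EuclideanSpace ℝ (Fin n)) a).indicator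
      (fun u => ENNReal.ofReal (‖u‖ ^ (-s)))) ha
    rw [lintegral_indicator measurableSet_closedBall] at h
    have e : ∀ u : EuclideanSpace ℝ (Fin n), (closedBall (0 : EuclideanSpace ℝ (Fin n)) a).indicator
      (fun u => ENNReal.ofReal (‖u‖ ^ (-s))) (a • u) = ENNReal.ofReal (a ^ (-s)) *
        (closedBall (0 : EuclideanSpace ℝ (Fin n)) 1).indicator
      (fun u => ENNReal.ofReal (‖u‖ ^ (-s))) u := by
      intro u
      by_cases hu : ‖u‖ ≤ 1
      · have h1 : a • u ∈ closedBall (0 : EuclideanSpace ℝ (Fin n)) a := by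
          simp [norm_smul, abs_of_pos ha]; nlinarith [norm_nonneg u]
        have h2 : u ∈ closedBall (0 : EuclideanSpace ℝ (Fin n)) 1 := by simpa using hu
        rw [Set.indicator_of_mem h1, Set.indicator_of_mem h2, norm_smul, Real.norm_eq_abs, abs_of_pos ha,
          Real.mul_rpow ha.le (norm_nonneg _), ENNReal.ofReal_mul (by positivity)]
      · have h1 : a • u ∉ closedBall (0 : EuclideanSpace ℝ (Fin n)) a := by
          simp [norm_smul, abs_of_pos ha]; nlinarith [norm_nonneg u]
        have h2 : u ∉ closedBall (0 : EuclideanSpace ℝ (Fin n)) 1 := by simpa using hu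
        rw [Set.indicator_of_notMem h1, Set.indicator_of_notMem h2, mul_zero]
    simp_rw [e] at h
    rw [lintegral_const_mul' _ _ (by finiteness), lintegral_indicator measurableSet_closedBall] at h
    have h3 : ENNReal.ofReal (a ^ n) * ENNReal.ofReal ((a ^ n)⁻¹) = 1 := by
      rw [← ENNReal.ofReal_mul (by positivity), mul_inv_cancel₀ (by positivity), ENNReal.ofReal_one]
    apply le_of_eq
    calc _ = ENNReal.ofReal (a ^ n) * (ENNReal.ofReal ((a ^ n)⁻¹) *
        ∫⁻ u in closedBall (0 : EuclideanSpace ℝ (Fin n)) a, ENNReal.ofReal (‖u‖ ^ (-s))) := by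
          rw [← mul_assoc, h3, one_mul]
      _ = _ := by
          rw [← h, ← mul_assoc, ← ENNReal.ofReal_mul (by positivity), mul_comm]
          congr 2
          rw [← Real.rpow_natCast, ← Real.rpow_add ha]; rfl

structure KerP (n : ℕ) (K : EuclideanSpace ℝ (Fin n) → ℝ) (A D β : ℝ) : Prop where
  meas : Measurable K
  A0 : 0 ≤ A
  D0 : 0 ≤ D
  bd : ∀ u, |K u| ≤ A * ‖u‖ ^ (-((n:ℝ) - 1))
  supp : ∀ u, 1 < ‖u‖ → K u = 0
  smooth : ∀ a, 0 < a → a ≤ 1 → ∀ u v, a ≤ ‖u‖ → ‖u‖ ≤ 1 → a ≤ ‖v‖ → ‖v‖ ≤ 1 → ‖u - v‖ ≤ 1 →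
    |K u - K v| ≤ D * ‖u - v‖ ^ β * a ^ (-(2 * (n:ℝ)))

lemma KerP.bdq {n : ℕ} {K : EuclideanSpace ℝ (Fin n) → ℝ} {A D β : ℝ} (h : KerP n K A D β)
    (hn : 1 ≤ n) (u : EuclideanSpace ℝ (Fin n)) :
    ‖K u‖ₑ ^ (((n:ℝ) + 1) / n) ≤ ENNReal.ofReal (A ^ (((n:ℝ) + 1) / n)) *
      ENNReal.ofReal (‖u‖ ^ (-((n:ℝ) - 1 / n))) := by
  have hn0 : (0:ℝ) < n := by exact_mod_cast hn
  have hA := h.A0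
  rw [← ENNReal.ofReal_mul (by positivity), ← ofReal_norm, ENNReal.ofReal_rpow_of_nonneg (norm_nonneg _) (by positivity)]
  apply ENNReal.ofReal_le_ofReal
  calc ‖K u‖ ^ (((n:ℝ) + 1) / n) ≤ (A * ‖u‖ ^ (-((n:ℝ) - 1))) ^ (((n:ℝ) + 1) / n) := by
        gcongr; exact h.bd u
    _ = _ := by
        rw [Real.mul_rpow hA (by positivity), ← Real.rpow_mul (norm_nonneg _)]
        congr 2
        field_simp; ring

lemma KerP.ballq {n : ℕ} (hn : 1 ≤ n) {K : EuclideanSpace ℝ (Fin n) → ℝ} {A D β : ℝ}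
    (h : KerP n K A D β) : ∃ C : ℝ≥0∞, C ≠ ⊤ ∧ ∀ a : ℝ, 0 < a →
    ∫⁻ u in closedBall (0 : EuclideanSpace ℝ (Fin n)) a, ‖K u‖ₑ ^ (((n:ℝ) + 1) / n) ≤
      C * ENNReal.ofReal (a ^ (1 / (n:ℝ))) := by
  have hn0 : (0:ℝ) < n := by exact_mod_cast hn
  obtain ⟨C, hC, hb⟩ := rad_int n hn ((n:ℝ) - 1 / n) (by simp; omega)
  refine ⟨ENNReal.ofReal (A ^ (((n:ℝ) + 1) / n)) * C, by finiteness, fun a ha => ?_⟩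
  refine (lintegral_mono fun u => h.bdq hn u).trans ?_
  rw [lintegral_const_mul' _ _ (by finiteness), mul_assoc]
  gcongr
  have := hb a ha
  simpa using this

lemma KerP.totq {n : ℕ} (hn : 1 ≤ n) {K : EuclideanSpace ℝ (Fin n) → ℝ} {A D β : ℝ}
    (h : KerP n K A D β) : ∫⁻ u, ‖K u‖ₑ ^ (((n:ℝ) + 1) / n) < ⊤ := by
  have hn0 : (0:ℝ) < n := by exact_mod_cast hn
  obtain ⟨C, hC, hb⟩ := h.ballq hn
  have := hb 1 one_pos
  have e : ∫⁻ u, ‖K u‖ₑ ^ (((n:ℝ) + 1) / n) =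
      ∫⁻ u in closedBall (0 : EuclideanSpace ℝ (Fin n)) 1, ‖K u‖ₑ ^ (((n:ℝ) + 1) / n) := by
    rw [← lintegral_indicator measurableSet_closedBall]
    congr 1; ext u
    by_cases hu : ‖u‖ ≤ 1
    · rw [Set.indicator_of_mem (by simpa using hu)]
    · rw [Set.indicator_of_notMem (by simpa using hu), h.supp u (not_le.1 hu)]
      simp; positivity
  rw [e]
  exact this.trans_lt (by finiteness)

lemma shell_vol (n : ℕ) (h : ℝ) (h0 : 0 < h) (h1 : h ≤ 1) :
    volume (closedBall (0 : EuclideanSpace ℝ (Fin n)) (1 + h) \ closedBall 0 (1 - h)) ≤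
      ENNReal.ofReal (2 * n * 2 ^ (n - 1) * h) * volume (closedBall (0 : EuclideanSpace ℝ (Fin n)) 1) := by
  rw [measure_sdiff (closedBall_subset_closedBall (by linarith)) measurableSet_closedBall.nullMeasurableSet
    (vol_fin n 0 _)]
  have e1 := vol_closedBall_mul n 0 0 (k := 1 + h) (s := 1) (by linarith) (by norm_num)
  have e2 := vol_closedBall_mul n 0 0 (k := 1 - h) (s := 1) (by linarith) (by norm_num)
  rw [mul_one] at e1 e2
  rw [e1, e2, ← ENNReal.sub_mul (fun _ _ => vol_fin n 0 1), ← ENNReal.ofReal_sub _ (by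
    have : 0 ≤ 1 - h := by linarith
    positivity)]
  gcongr
  have := abs_pow_sub_pow_le (1 + h) (1 - h) n
  have h3 : max |1 + h| |1 - h| ≤ 2 := by
    rw [abs_of_nonneg (by linarith), abs_of_nonneg (by linarith)]
    apply max_le <;> linarith
  calc _ ≤ _ := le_abs_self _
    _ ≤ _ := this
    _ ≤ |1 + h - (1 - h)| * n * 2 ^ (n - 1) := by gcongr
    _ = _ := by
      have : (1 + h - (1 - h)) = 2 * h := by ring
      rw [this, abs_of_pos (by linarith)]; ring


lemma KerP.modq {n : ℕ} (hn : 1 ≤ n) {K : EuclideanSpace ℝ (Fin n) → ℝ} {A D β : ℝ}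
    (hβ0 : 0 < β) (hβ1 : β < 1)
    (h : KerP n K A D β) : ∃ C : ℝ≥0∞, C ≠ ⊤ ∧ ∀ η : EuclideanSpace ℝ (Fin n), ‖η‖ ≤ 1 →
    ∫⁻ u, ‖K (u - η) - K u‖ₑ ^ (((n:ℝ) + 1) / n) ≤
      C * ENNReal.ofReal (‖η‖ ^ (β / (4 * n ^ 2))) := by
  have hn0 : (0:ℝ) < n := by exact_mod_cast hn
  have hn1 : (1:ℝ) ≤ n := by exact_mod_cast hn
  set q := ((n:ℝ) + 1) / n with hq
  have hq0 : 0 < q := by positivity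
  have hq1 : 1 ≤ q := by rw [hq, le_div_iff₀ hn0]; linarith
  obtain ⟨C, hC, hb⟩ := h.ballq hn
  rw [← hq] at hb
  set V := volume (closedBall (0 : EuclideanSpace ℝ (Fin n)) 1) with hV
  have hVf : V ≠ ⊤ := vol_fin n 0 1
  set C1 : ℝ≥0∞ := 2 ^ (q - 1) * (C * ENNReal.ofReal (3 ^ (1 / (n:ℝ))) + C * ENNReal.ofReal (2 ^ (1 / (n:ℝ)))) with hC1
  set C2 : ℝ≥0∞ := ENNReal.ofReal ((2 * A) ^ q) * (ENNReal.ofReal (2 * n * 2 ^ (n - 1)) * V) with hC2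
  set C3 : ℝ≥0∞ := ENNReal.ofReal (D ^ q) * V with hC3
  have hA := h.A0
  have hD := h.D0
  refine ⟨C1 + (C2 + C3), by finiteness, fun η hη1 => ?_⟩
  by_cases hη0 : η = 0
  · simp [hη0, hq0]
  have hp : 0 < ‖η‖ := norm_pos_iff.2 hη0
  set d := ‖η‖ with hd
  set a := d ^ (β / (4 * n)) with ha
  have ha0 : 0 < a := by positivity
  have ha1 : a ≤ 1 := Real.rpow_le_one hp.le hη1 (by positivity)
  have hda : d ≤ a := by
    calc d = d ^ (1:ℝ) := (Real.rpow_one d).symm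
      _ ≤ _ := Real.rpow_le_rpow_of_exponent_ge hp hη1 (by
        rw [div_le_one (by positivity)]; linarith)
  set F : EuclideanSpace ℝ (Fin n) → ℝ≥0∞ := fun u => ‖K (u - η) - K u‖ₑ ^ q with hF
  set S1 := closedBall (0 : EuclideanSpace ℝ (Fin n)) (2 * a) with hS1
  set S2 := (closedBall (0 : EuclideanSpace ℝ (Fin n)) (1 + d) \ closedBall 0 (1 - d)) \ S1 with hS2
  set S3 := closedBall (0 : EuclideanSpace ℝ (Fin n)) (1 - d) \ S1 with hS3
  have hS2m : MeasurableSet S2 := (measurableSet_closedBall.diff measurableSet_closedBall).diff measurableSet_closedBall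
  have hS3m : MeasurableSet S3 := measurableSet_closedBall.diff measurableSet_closedBall
  have hnorm1 : ∀ u : EuclideanSpace ℝ (Fin n), ‖u‖ ≤ ‖u - η‖ + d := fun u => by
    have := norm_add_le (u - η) η; simpa using this
  have hnorm2 : ∀ u : EuclideanSpace ℝ (Fin n), ‖u - η‖ ≤ ‖u‖ + d := fun u => norm_sub_le u η
  have hI1 : ∫⁻ u in S1, F u ≤ C1 * ENNReal.ofReal (d ^ (β / (4 * n ^ 2))) := by
    have hae : a ^ (1 / (n:ℝ)) = d ^ (β / (4 * n ^ 2)) := by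
      rw [ha, ← Real.rpow_mul hp.le]; congr 1; field_simp
    have hpt : ∀ u, F u ≤ 2 ^ (q - 1) * (‖K (u - η)‖ₑ ^ q + ‖K u‖ₑ ^ q) := by
      intro u
      refine le_trans ?_ (ENNReal.rpow_add_le_mul_rpow_add_rpow _ _ hq1)
      simp only [hF]
      gcongr
      exact enorm_sub_le
    refine (lintegral_mono hpt).trans ?_
    rw [lintegral_const_mul' _ _ (by finiteness), hC1, mul_assoc]
    gcongr
    rw [lintegral_add_right _ (by exact h.meas.enorm.pow_const q), add_mul]
    gcongr
    · rw [← lintegral_indicator measurableSet_closedBall]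
      have := hb (3 * a) (by positivity)
      rw [Real.mul_rpow (by norm_num) ha0.le, ENNReal.ofReal_mul (by positivity), ← mul_assoc, hae] at this
      refine le_trans ?_ this
      rw [← lintegral_indicator measurableSet_closedBall,
        ← lintegral_sub_right_eq_self ((closedBall (0 : EuclideanSpace ℝ (Fin n)) (3 * a)).indicator
          (fun u => ‖K u‖ₑ ^ q)) η]
      apply lintegral_mono
      intro u
      simp only
      by_cases hu : u ∈ S1
      · rw [Set.indicator_of_mem hu, Set.indicator_of_mem]
        simp only [hS1, mem_closedBall, dist_zero_right] at hu ⊢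
        linarith [hnorm2 u]
      · rw [Set.indicator_of_notMem hu]; exact zero_le
    · have := hb (2 * a) (by positivity)
      rwa [Real.mul_rpow (by norm_num) ha0.le, ENNReal.ofReal_mul (by positivity), ← mul_assoc, hae] at this
  have hKa : ∀ v : EuclideanSpace ℝ (Fin n), a ≤ ‖v‖ → |K v| ≤ A * a ^ (-((n:ℝ) - 1)) := by
    intro v hv
    refine (h.bd v).trans ?_
    gcongr ?_ * ?_
    exact Real.rpow_le_rpow_of_nonpos ha0 hv (by linarith)
  have hI2 : ∫⁻ u in S2, F u ≤ C2 * ENNReal.ofReal (d ^ (β / (4 * n ^ 2))) := by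
    calc _ ≤ ∫⁻ u in S2, ENNReal.ofReal ((2 * A) ^ q * a ^ (-(n:ℝ))) := by
          apply setLIntegral_mono measurable_const
          intro u hu
          simp only [hF]
          rw [← ofReal_norm, ENNReal.ofReal_rpow_of_nonneg (norm_nonneg _) hq0.le]
          apply ENNReal.ofReal_le_ofReal
          have hu2 : 2 * a < ‖u‖ := by
            have := hu.2; simpa [hS1] using this
          have h1 := hKa u (by linarith)
          have h2 := hKa (u - η) (by linarith [hnorm1 u])
          have h3 : ‖K (u - η) - K u‖ ≤ (2 * A) * a ^ (-((n:ℝ) - 1)) := by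
            have := norm_sub_le (K (u - η)) (K u)
            rw [Real.norm_eq_abs, Real.norm_eq_abs (K (u - η)), Real.norm_eq_abs (K u)] at this
            rw [Real.norm_eq_abs]
            linarith
          calc _ ≤ ((2 * A) * a ^ (-((n:ℝ) - 1))) ^ q := by gcongr
            _ = (2 * A) ^ q * a ^ (-((n:ℝ) - 1) * q) := by
              rw [Real.mul_rpow (by positivity) (by positivity), ← Real.rpow_mul ha0.le]
            _ ≤ _ := by
              gcongr ?_ * ?_
              apply Real.rpow_le_rpow_of_exponent_ge ha0 ha1
              rw [hq, neg_mul, neg_le_neg_iff, ← mul_div_assoc, div_le_iff₀ hn0]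
              nlinarith
      _ = ENNReal.ofReal ((2 * A) ^ q * a ^ (-(n:ℝ))) * volume S2 := by rw [setLIntegral_const]
      _ ≤ ENNReal.ofReal ((2 * A) ^ q * a ^ (-(n:ℝ))) * (ENNReal.ofReal (2 * n * 2 ^ (n - 1) * d) * V) := by
          gcongr
          exact (measure_mono Set.sdiff_subset).trans (shell_vol n d hp hη1)
      _ ≤ _ := by
          rw [hC2, ENNReal.ofReal_mul (by positivity), ENNReal.ofReal_mul (q := d) (by positivity)]
          have : ENNReal.ofReal (a ^ (-(n:ℝ))) * ENNReal.ofReal d ≤ ENNReal.ofReal (d ^ (β / (4 * n ^ 2))) := by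
            rw [← ENNReal.ofReal_mul (by positivity)]
            apply ENNReal.ofReal_le_ofReal
            rw [ha, ← Real.rpow_mul hp.le]
            nth_rewrite 2 [← Real.rpow_one d]
            rw [← Real.rpow_add hp]
            apply Real.rpow_le_rpow_of_exponent_ge hp hη1
            have e1 : β / (4 * n) * -(n:ℝ) = - (β / 4) := by field_simp
            rw [e1]
            have : β / (4 * n ^ 2) ≤ β / 4 := by gcongr; nlinarith
            linarith
          calc _ = ENNReal.ofReal ((2 * A) ^ q) * (ENNReal.ofReal (2 * ↑n * 2 ^ (n - 1)) * V) *
                (ENNReal.ofReal (a ^ (-(n:ℝ))) * ENNReal.ofReal d) := by ring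
            _ ≤ _ := by gcongr
  have hI3 : ∫⁻ u in S3, F u ≤ C3 * ENNReal.ofReal (d ^ (β / (4 * n ^ 2))) := by
    calc _ ≤ ∫⁻ u in S3, ENNReal.ofReal (D ^ q * d ^ (β / (4 * n ^ 2))) := by
          apply setLIntegral_mono measurable_const
          intro u hu
          simp only [hF]
          rw [← ofReal_norm, ENNReal.ofReal_rpow_of_nonneg (norm_nonneg _) hq0.le]
          apply ENNReal.ofReal_le_ofReal
          have hu2 : 2 * a < ‖u‖ := by
            have := hu.2; simpa [hS1] using this
          have hu1 : ‖u‖ ≤ 1 - d := by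
            have := hu.1; simpa using this
          have h3 := h.smooth a ha0 ha1 (u - η) u (by linarith [hnorm1 u]) (by linarith [hnorm2 u])
            (by linarith) (by linarith) (by simpa using hη1)
          have e1 : ‖u - η - u‖ = d := by simp [hd]
          rw [e1] at h3
          calc _ ≤ (D * d ^ β * a ^ (-(2 * (n:ℝ)))) ^ q := by gcongr; exact h3
            _ = D ^ q * (d ^ (β / 2)) ^ q := by
              rw [mul_assoc, Real.mul_rpow hD (by positivity), ha, ← Real.rpow_mul hp.le, ← Real.rpow_add hp]
              congr 3
              field_simp; ring
            _ ≤ _ := by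
              gcongr ?_ * ?_
              rw [← Real.rpow_mul hp.le]
              apply Real.rpow_le_rpow_of_exponent_ge hp hη1
              have : β / (4 * n ^ 2) ≤ β / 2 := by gcongr; nlinarith
              nlinarith
      _ = ENNReal.ofReal (D ^ q * d ^ (β / (4 * n ^ 2))) * volume S3 := by rw [setLIntegral_const]
      _ ≤ ENNReal.ofReal (D ^ q * d ^ (β / (4 * n ^ 2))) * V := by
          gcongr
          exact (measure_mono (Set.sdiff_subset.trans (closedBall_subset_closedBall (by linarith))))
      _ = _ := by
          rw [hC3, ENNReal.ofReal_mul (by positivity)]; ring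
  have hI4 : ∫⁻ u in (closedBall (0 : EuclideanSpace ℝ (Fin n)) (1 + d))ᶜ, F u = 0 := by
    rw [setLIntegral_congr_fun measurableSet_closedBall.compl (g := fun _ => 0)]
    · simp
    · intro u hu
      have hu1 : 1 + d < ‖u‖ := by simpa using hu
      simp only [hF]
      rw [h.supp u (by linarith), h.supp (u - η) (by linarith [hnorm1 u])]
      simp [hq0]
  have hcov : (Set.univ : Set (EuclideanSpace ℝ (Fin n))) ⊆
      S1 ∪ (S2 ∪ (S3 ∪ (closedBall (0 : EuclideanSpace ℝ (Fin n)) (1 + d))ᶜ)) := by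
    intro u _
    by_cases h1 : u ∈ S1
    · exact Or.inl h1
    by_cases h2 : u ∈ closedBall (0 : EuclideanSpace ℝ (Fin n)) (1 + d)
    · by_cases h3 : u ∈ closedBall (0 : EuclideanSpace ℝ (Fin n)) (1 - d)
      · exact Or.inr (Or.inr (Or.inl ⟨h3, h1⟩))
      · exact Or.inr (Or.inl ⟨⟨h2, h3⟩, h1⟩)
    · exact Or.inr (Or.inr (Or.inr h2))
  calc ∫⁻ u, F u = ∫⁻ u in Set.univ, F u := by rw [Measure.restrict_univ]
    _ ≤ ∫⁻ u in S1 ∪ (S2 ∪ (S3 ∪ (closedBall (0 : EuclideanSpace ℝ (Fin n)) (1 + d))ᶜ)), F u :=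
        lintegral_mono_set hcov
    _ ≤ (∫⁻ u in S1, F u) + ((∫⁻ u in S2, F u) + ((∫⁻ u in S3, F u) + 0)) := by
        refine (lintegral_union_le _ _ _).trans ?_
        gcongr
        refine (lintegral_union_le _ _ _).trans ?_
        gcongr
        refine (lintegral_union_le _ _ _).trans ?_
        rw [hI4]
    _ ≤ _ := by
        rw [add_zero, add_mul, add_mul]
        gcongr


noncomputable def mkK (n : ℕ) (Ω : EuclideanSpace ℝ (Fin n) → ℝ) (u : EuclideanSpace ℝ (Fin n)) : ℝ :=
  if u = 0 ∨ 1 < ‖u‖ then 0 else Ω u / ‖u‖ ^ ((n:ℝ) - 1)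

lemma Om_meas (n : ℕ) (Ω : EuclideanSpace ℝ (Fin n) → ℝ) (β C₀ : ℝ) (hβ0 : 0 < β) 
    (hΩlip : ∀ (ξ η : EuclideanSpace ℝ (Fin n)), ξ ≠ 0 → η ≠ 0 →
      |Ω ξ - Ω η| ≤ C₀ * ‖‖ξ‖⁻¹ • ξ - ‖η‖⁻¹ • η‖ ^ β) : Measurable Ω := by
  apply measurable_of_continuousOn_compl_singleton 0
  intro x hx
  have hx0 : x ≠ 0 := hx
  apply ContinuousAt.continuousWithinAt
  rw [ContinuousAt, tendsto_iff_norm_sub_tendsto_zero]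
  have hc : ContinuousAt (fun y : EuclideanSpace ℝ (Fin n) =>
      C₀ * ‖‖y‖⁻¹ • y - ‖x‖⁻¹ • x‖ ^ β) x := by
    apply ContinuousAt.mul continuousAt_const
    apply ContinuousAt.rpow_const _ (Or.inr hβ0.le)
    apply ContinuousAt.norm
    apply ContinuousAt.sub _ continuousAt_const
    exact (continuous_norm.continuousAt.inv₀ (norm_ne_zero_iff.2 hx0)).smul continuousAt_id
  have h0 : Filter.Tendsto (fun y : EuclideanSpace ℝ (Fin n) =>
      C₀ * ‖‖y‖⁻¹ • y - ‖x‖⁻¹ • x‖ ^ β) (nhds x) (nhds 0) := by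
    have := hc.tendsto
    simpa [Real.zero_rpow hβ0.ne'] using this
  apply squeeze_zero' _ _ h0
  · filter_upwards with y; positivity
  · filter_upwards [isOpen_ne.mem_nhds hx0] with y hy
    exact hΩlip y x hy hx0

lemma unit_diff {n : ℕ} (u v : EuclideanSpace ℝ (Fin n)) (hu : u ≠ 0) (hv : v ≠ 0) :
    ‖‖u‖⁻¹ • u - ‖v‖⁻¹ • v‖ ≤ 2 * ‖u - v‖ / ‖u‖ := by
  have hu' : 0 < ‖u‖ := norm_pos_iff.2 hu
  have hv' : 0 < ‖v‖ := norm_pos_iff.2 hv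
  have e : ‖u‖⁻¹ • u - ‖v‖⁻¹ • v = ‖u‖⁻¹ • (u - v) + (‖u‖⁻¹ - ‖v‖⁻¹) • v := by
    rw [smul_sub, sub_smul]; abel
  rw [e]
  refine (norm_add_le _ _).trans ?_
  rw [norm_smul, norm_smul, norm_inv, norm_norm]
  have h2 : ‖‖u‖⁻¹ - ‖v‖⁻¹‖ * ‖v‖ ≤ ‖u - v‖ / ‖u‖ := by
    have : ‖u‖⁻¹ - ‖v‖⁻¹ = (‖v‖ - ‖u‖) * (‖u‖⁻¹ * ‖v‖⁻¹) := by field_simp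
    rw [this, norm_mul, Real.norm_of_nonneg (by positivity : 0 ≤ ‖u‖⁻¹ * ‖v‖⁻¹)]
    have h3 : ‖‖v‖ - ‖u‖‖ ≤ ‖u - v‖ := by
      rw [Real.norm_eq_abs, norm_sub_rev]; exact abs_norm_sub_norm_le v u
    calc _ = ‖‖v‖ - ‖u‖‖ / ‖u‖ := by field_simp
      _ ≤ _ := by gcongr
  calc _ ≤ ‖u‖⁻¹ * ‖u - v‖ + ‖u - v‖ / ‖u‖ := by gcongr
    _ = _ := by field_simp; ring

lemma mkK_KerP (n : ℕ) (hn : 1 ≤ n) (Ω : EuclideanSpace ℝ (Fin n) → ℝ) (β C₀ : ℝ) (hβ0 : 0 < β) (hβ1 : β < 1)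
    (hC₀ : 0 < C₀)
    (hΩlip : ∀ (ξ η : EuclideanSpace ℝ (Fin n)), ξ ≠ 0 → η ≠ 0 →
      |Ω ξ - Ω η| ≤ C₀ * ‖‖ξ‖⁻¹ • ξ - ‖η‖⁻¹ • η‖ ^ β) :
    ∃ A D, KerP n (mkK n Ω) A D β := by
  have hn1 : (1:ℝ) ≤ n := by exact_mod_cast hn
  have hΩm := Om_meas n Ω β C₀ hβ0 hΩlip
  obtain ⟨A, hA0, hA⟩ : ∃ A, 0 ≤ A ∧ ∀ u, u ≠ 0 → |Ω u| ≤ A := by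
    let e : EuclideanSpace ℝ (Fin n) := EuclideanSpace.single ⟨0, hn⟩ 1
    have he : e ≠ 0 := by
      intro h
      have : ‖e‖ = 1 := by simp [e]
      rw [h] at this; simp at this
    refine ⟨|Ω e| + C₀ * 2 ^ β, by positivity, fun u hu => ?_⟩
    have h1 := hΩlip u e hu he
    have h2 : ‖‖u‖⁻¹ • u - ‖e‖⁻¹ • e‖ ≤ 2 := by
      refine (norm_sub_le _ _).trans ?_
      have h7 : ∀ w : EuclideanSpace ℝ (Fin n), w ≠ 0 → ‖‖w‖⁻¹ • w‖ = 1 := by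
        intro w hw
        rw [norm_smul, norm_inv, norm_norm, inv_mul_cancel₀ (norm_ne_zero_iff.2 hw)]
      rw [h7 u hu, h7 e he]; norm_num
    have h3 : |Ω u| ≤ |Ω e| + |Ω u - Ω e| := by
      have := abs_add_le (Ω e) (Ω u - Ω e); simpa using this
    have h4 : C₀ * ‖‖u‖⁻¹ • u - ‖e‖⁻¹ • e‖ ^ β ≤ C₀ * 2 ^ β := by gcongr
    linarith
  refine ⟨A, 2 * C₀ + A * n, ⟨?_, hA0, by positivity, ?_, ?_, ?_⟩⟩
  · unfold mkK
    apply Measurable.ite _ measurable_const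
    · exact hΩm.div (by fun_prop)
    · apply MeasurableSet.union (measurableSet_singleton 0)
      exact measurableSet_lt measurable_const measurable_norm
  · intro u
    unfold mkK
    split_ifs with h
    · simp; positivity
    · push Not at h
      rw [abs_div, abs_of_nonneg (by positivity : 0 ≤ ‖u‖ ^ ((n:ℝ) - 1)), Real.rpow_neg (norm_nonneg _), div_eq_mul_inv]
      gcongr
      exact hA u h.1
  · intro u hu
    simp [mkK, hu]
  · intro a ha0 ha1 u v hau hu1 hav hv1 huv
    have hu' : 0 < ‖u‖ := ha0.trans_le hau
    have hv' : 0 < ‖v‖ := ha0.trans_le hav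
    have hu0 : u ≠ 0 := norm_pos_iff.1 hu'
    have hv0 : v ≠ 0 := norm_pos_iff.1 hv'
    have ek : ∀ x : EuclideanSpace ℝ (Fin n), ‖x‖ ^ ((n:ℝ) - 1) = ‖x‖ ^ (n - 1) := by
      intro x
      rw [← Real.rpow_natCast]; congr 1; push_cast [hn]; rfl
    have eu : mkK n Ω u = Ω u / ‖u‖ ^ (n - 1) := by simp [mkK, hu0, not_lt.2 hu1, ek]
    have ev : mkK n Ω v = Ω v / ‖v‖ ^ (n - 1) := by simp [mkK, hv0, not_lt.2 hv1, ek]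
    rw [eu, ev]
    have e : Ω u / ‖u‖ ^ (n - 1) - Ω v / ‖v‖ ^ (n - 1) =
        (Ω u - Ω v) / ‖u‖ ^ (n - 1) + Ω v * ((‖v‖ ^ (n - 1) - ‖u‖ ^ (n - 1)) / (‖u‖ ^ (n - 1) * ‖v‖ ^ (n - 1))) := by
      field_simp; ring
    rw [e]
    refine (abs_add_le _ _).trans ?_
    set d := ‖u - v‖ with hd
    have hd0 : 0 ≤ d := norm_nonneg _
    have h1 : |(Ω u - Ω v) / ‖u‖ ^ (n - 1)| ≤ 2 * C₀ * d ^ β * a ^ (-(2 * (n:ℝ))) := by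
      rw [abs_div, abs_of_pos (by positivity : 0 < ‖u‖ ^ (n - 1))]
      calc _ ≤ (C₀ * (2 * d / a) ^ β) / a ^ (n - 1) := by
            gcongr
            refine (hΩlip u v hu0 hv0).trans ?_
            gcongr
            exact (unit_diff u v hu0 hv0).trans (by gcongr)
        _ = C₀ * (2 ^ β * (d ^ β)) * a ^ (-(β + (n - 1))) := by
            rw [Real.div_rpow (by positivity) ha0.le, Real.mul_rpow (by norm_num) hd0, Real.rpow_neg ha0.le,
              Real.rpow_add ha0]
            have : a ^ ((n:ℝ) - 1) = a ^ (n - 1) := by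
              rw [← Real.rpow_natCast]; congr 1; push_cast [hn]; rfl
            rw [this]; field_simp
        _ ≤ C₀ * (2 * d ^ β) * a ^ (-(2 * (n:ℝ))) := by
            gcongr ?_ * (?_ * ?_) * ?_
            · calc (2:ℝ) ^ β ≤ 2 ^ (1:ℝ) := Real.rpow_le_rpow_of_exponent_le (by norm_num) hβ1.le
                _ = 2 := by norm_num
            · exact Real.rpow_le_rpow_of_exponent_ge ha0 ha1 (by linarith)
        _ = _ := by ring
    have h2 : |Ω v * ((‖v‖ ^ (n - 1) - ‖u‖ ^ (n - 1)) / (‖u‖ ^ (n - 1) * ‖v‖ ^ (n - 1)))| ≤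
        A * n * d ^ β * a ^ (-(2 * (n:ℝ))) := by
      rw [abs_mul, abs_div, abs_of_pos (by positivity : 0 < ‖u‖ ^ (n - 1) * ‖v‖ ^ (n - 1))]
      have h3 : |‖v‖ ^ (n - 1) - ‖u‖ ^ (n - 1)| ≤ n * d ^ β := by
        refine (abs_pow_sub_pow_le _ _ _).trans ?_
        have h4 : |‖v‖ - ‖u‖| ≤ d := by rw [hd, norm_sub_rev]; exact abs_norm_sub_norm_le v u
        have h5 : max |‖v‖| |‖u‖| ^ (n - 1 - 1) ≤ 1 := by
          apply pow_le_one₀ (by positivity)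
          simp [hu1, hv1]
        have h6 : d ≤ d ^ β := by
          rcases hd0.eq_or_lt with h | h
          · rw [← h, Real.zero_rpow hβ0.ne']
          · calc d = d ^ (1:ℝ) := (Real.rpow_one d).symm
              _ ≤ _ := Real.rpow_le_rpow_of_exponent_ge h huv hβ1.le
        calc _ ≤ d * ((n - 1 : ℕ) : ℝ) * 1 := by gcongr
          _ ≤ d ^ β * n * 1 := by gcongr; omega
          _ = _ := by ring
      calc _ ≤ A * ((n * d ^ β) / (a ^ (n - 1) * a ^ (n - 1))) := by
            gcongr
            exact hA v hv0
        _ = A * n * d ^ β * a ^ (-(2 * ((n:ℝ) - 1))) := by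
            rw [Real.rpow_neg ha0.le, two_mul, Real.rpow_add ha0]
            have : a ^ ((n:ℝ) - 1) = a ^ (n - 1) := by
              rw [← Real.rpow_natCast]; congr 1; push_cast [hn]; rfl
            rw [this]; field_simp
        _ ≤ _ := by
            gcongr ?_ * ?_
            exact Real.rpow_le_rpow_of_exponent_ge ha0 ha1 (by linarith)
    calc _ ≤ _ := add_le_add h1 h2
      _ = _ := by ring

lemma mkK_int (n : ℕ) (Ω : EuclideanSpace ℝ (Fin n) → ℝ) 
    (hΩhom : ∀ (l : ℝ), 0 < l → ∀ y : EuclideanSpace ℝ (Fin n), Ω (l • y) = Ω y)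
    (hΩvan : ∫ z : sphere (0 : EuclideanSpace ℝ (Fin n)) 1, Ω (z : EuclideanSpace ℝ (Fin n))
        ∂(volume : Measure (EuclideanSpace ℝ (Fin n))).toSphere = 0) (hn : 1 ≤ n) :
    ∫ u, mkK n Ω u = 0 := by
  have : Nonempty (Fin n) := ⟨⟨0, hn⟩⟩
  let φ : Set.Ioi (0:ℝ) → ℝ := fun r => if 1 < (r:ℝ) then 0 else ((r:ℝ) ^ ((n:ℝ) - 1))⁻¹
  calc
    ∫ u, mkK n Ω u = ∫ x : ({(0)}ᶜ : Set (EuclideanSpace ℝ (Fin n))), mkK n Ω x.1 ∂((volume : Measure (EuclideanSpace ℝ (Fin n))).comap (↑)) := by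
      rw [integral_subtype_comap (measurableSet_singleton _).compl fun x ↦ mkK n Ω x,
        restrict_compl_singleton]
    _ = ∫ p, Ω (p.1 : EuclideanSpace ℝ (Fin n)) * φ p.2 ∂(volume : Measure (EuclideanSpace ℝ (Fin n))).toSphere.prod (.volumeIoiPow (Module.finrank ℝ (EuclideanSpace ℝ (Fin n)) - 1)) := by
      rw [← (volume : Measure (EuclideanSpace ℝ (Fin n))).measurePreserving_homeomorphUnitSphereProd.integral_comp
        (Homeomorph.measurableEmbedding _)]
      congr 1
      ext ⟨x, hx⟩
      have hx0 : x ≠ 0 := hx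
      have hxp : 0 < ‖x‖ := norm_pos_iff.2 hx0
      simp only [homeomorphUnitSphereProd_apply_fst_coe, homeomorphUnitSphereProd_apply_snd_coe, φ]
      rw [hΩhom _ (inv_pos.2 hxp)]
      by_cases h : 1 < ‖x‖
      · simp [mkK, h]
      · simp [mkK, h, hx0, div_eq_mul_inv]
    _ = 0 := by
      rw [integral_prod_mul (fun z : sphere (0 : EuclideanSpace ℝ (Fin n)) 1 => Ω (z : EuclideanSpace ℝ (Fin n))) φ, hΩvan, zero_mul]


lemma holderM {n : ℕ} (hn : 1 ≤ n) (M : EuclideanSpace ℝ (Fin n) → ℝ) (hM : Measurable M)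
    (hs : ∀ u, 2 < ‖u‖ → M u = 0) (φ : EuclideanSpace ℝ (Fin n) → ℝ≥0∞) (hφ : Measurable φ) :
    ∫⁻ u, ‖M u‖ₑ * φ u ≤ (∫⁻ u, ‖M u‖ₑ ^ (((n:ℝ) + 1) / n)) ^ ((n:ℝ) / (n + 1)) *
      (∫⁻ u in closedBall 0 2, φ u ^ (n + 1)) ^ (1 / ((n:ℝ) + 1)) := by
  have hn0 : (0:ℝ) < n := by exact_mod_cast hn
  have hpq : (((n:ℝ) + 1) / n).HolderConjugate ((n:ℝ) + 1) := by
    rw [Real.holderConjugate_iff]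
    refine ⟨by rw [lt_div_iff₀ hn0]; linarith, by field_simp⟩
  have e : ∫⁻ u, ‖M u‖ₑ * φ u = ∫⁻ u in closedBall 0 2, ‖M u‖ₑ * φ u := by
    rw [← lintegral_indicator measurableSet_closedBall]
    congr 1; ext u
    by_cases hu : ‖u‖ ≤ 2
    · rw [Set.indicator_of_mem (by simpa using hu)]
    · rw [Set.indicator_of_notMem (by simpa using hu), hs u (not_le.1 hu)]
      simp
  rw [e]
  refine (ENNReal.lintegral_mul_le_Lp_mul_Lq _ hpq hM.enorm.aemeasurable hφ.aemeasurable).trans ?_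
  rw [one_div_div]
  gcongr ?_ ^ _ * ?_ ^ _
  · exact setLIntegral_le_lintegral _ _
  · apply le_of_eq; congr 1; ext u
    rw [← ENNReal.rpow_natCast]; push_cast; rfl

lemma M_int {n : ℕ} (hn : 1 ≤ n) (M : EuclideanSpace ℝ (Fin n) → ℝ) (hM : Measurable M)
    (hs : ∀ u, 2 < ‖u‖ → M u = 0) :
    ∫⁻ u, ‖M u‖ₑ ≤ (∫⁻ u, ‖M u‖ₑ ^ (((n:ℝ) + 1) / n)) ^ ((n:ℝ) / (n + 1)) *
      volume (closedBall (0 : EuclideanSpace ℝ (Fin n)) 2) ^ (1 / ((n:ℝ) + 1)) := by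
  have := holderM hn M hM hs (fun _ => 1) measurable_const
  simpa using this

lemma M_integrable {n : ℕ} (hn : 1 ≤ n) (M : EuclideanSpace ℝ (Fin n) → ℝ) (hM : Measurable M)
    (hs : ∀ u, 2 < ‖u‖ → M u = 0) (hq : ∫⁻ u, ‖M u‖ₑ ^ (((n:ℝ) + 1) / n) ≠ ⊤) :
    Integrable M volume := by
  refine ⟨hM.aestronglyMeasurable, (M_int hn M hM hs).trans_lt ?_⟩
  have := vol_fin n 0 2
  apply ENNReal.mul_lt_top <;> apply ENNReal.rpow_lt_top_of_nonneg (by positivity) (by assumption)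

lemma cov_ball (n : ℕ) (φ : EuclideanSpace ℝ (Fin n) → ℝ≥0∞) (x : EuclideanSpace ℝ (Fin n)) {t : ℝ}
    (ht : 0 < t) : ∫⁻ u in closedBall 0 2, φ (x - t • u) =
      ENNReal.ofReal ((t ^ n)⁻¹) * ∫⁻ y in closedBall x (t * 2), φ y := by
  have h1 := lint_smul n (fun w => (closedBall x (t * 2)).indicator φ (x - w)) ht
  rw [lintegral_sub_left_eq_self ((closedBall x (t * 2)).indicator φ) x,
    lintegral_indicator measurableSet_closedBall] at h1
  rw [← h1, ← lintegral_indicator measurableSet_closedBall]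
  congr 1; ext u
  by_cases hu : ‖u‖ ≤ 2
  · rw [Set.indicator_of_mem (by simpa using hu), Set.indicator_of_mem]
    simp [norm_smul, abs_of_pos ht]; nlinarith
  · rw [Set.indicator_of_notMem (by simpa using hu), Set.indicator_of_notMem]
    simp [norm_smul, abs_of_pos ht]; nlinarith

lemma pairing (n : ℕ) (hn : 1 ≤ n) : ∃ C : ℝ≥0∞, C ≠ ⊤ ∧ ∀ (f : EuclideanSpace ℝ (Fin n) → ℝ)
    (_ : Measurable f) (a : EuclideanSpace ℝ (Fin n) → ℝ → ℝ) (N : ℝ≥0∞), N ≠ ⊤ → OscBd n f a 1 N →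
    ∀ M : EuclideanSpace ℝ (Fin n) → ℝ, Measurable M → (∀ u, 2 < ‖u‖ → M u = 0) →
    ∫⁻ u, ‖M u‖ₑ ^ (((n:ℝ) + 1) / n) ≠ ⊤ → ∀ t : ℝ, 0 < t → ∀ x : EuclideanSpace ℝ (Fin n),
    Integrable (fun u => M u * f (x - t • u)) volume ∧
    (∫ u, M u = 0 → ‖∫ u, M u * f (x - t • u)‖ₑ ≤
      C * N * (∫⁻ u, ‖M u‖ₑ ^ (((n:ℝ) + 1) / n)) ^ ((n:ℝ) / (n + 1))) := by
  have hn0 : (0:ℝ) < n := by exact_mod_cast hn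
  obtain ⟨J, hJ, hjn⟩ := jn n (n + 1) (by omega)
  set V := volume (closedBall (0 : EuclideanSpace ℝ (Fin n)) 2) with hV
  have hVf : V ≠ ⊤ := vol_fin n 0 2
  refine ⟨(J * V) ^ (1 / ((n:ℝ) + 1)), by finiteness, ?_⟩
  intro f hf a N hN hosc M hM hs hq t ht x
  set κ := a x (t * 2) with hκ
  have hJN := hjn f hf.aemeasurable a N hN hosc x (t * 2) (by positivity)
  have hfx : Measurable fun u => f (x - t • u) - κ := by
    apply Measurable.sub_const; apply hf.comp; fun_prop
  have hmain : ∫⁻ u, ‖M u * (f (x - t • u) - κ)‖ₑ ≤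
      (J * V) ^ (1 / ((n:ℝ) + 1)) * N * (∫⁻ u, ‖M u‖ₑ ^ (((n:ℝ) + 1) / n)) ^ ((n:ℝ) / (n + 1)) := by
    simp_rw [enorm_mul]
    refine (holderM hn M hM hs _ hfx.enorm).trans ?_
    rw [mul_comm]
    gcongr
    rw [cov_ball n (fun y => ‖f y - κ‖ₑ ^ (n + 1)) x ht]
    calc _ ≤ (ENNReal.ofReal ((t ^ n)⁻¹) * (J * N ^ (n + 1) * (ENNReal.ofReal (t ^ n) * V))) ^ (1 / ((n:ℝ) + 1)) := by
          gcongr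
          rw [← vol_closedBall_mul n x 0 ht.le (by norm_num)]
          exact hJN
      _ = (J * V * N ^ (n + 1)) ^ (1 / ((n:ℝ) + 1)) := by
          congr 1
          have : ENNReal.ofReal ((t ^ n)⁻¹) * ENNReal.ofReal (t ^ n) = 1 := by
            rw [← ENNReal.ofReal_mul (by positivity), inv_mul_cancel₀ (by positivity), ENNReal.ofReal_one]
          calc _ = (ENNReal.ofReal ((t ^ n)⁻¹) * ENNReal.ofReal (t ^ n)) * (J * V * N ^ (n + 1)) := by ring
            _ = _ := by rw [this, one_mul]
      _ = _ := by
          rw [ENNReal.mul_rpow_of_nonneg _ _ (by positivity)]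
          congr 1
          rw [← ENNReal.rpow_natCast, ← ENNReal.rpow_mul]
          push_cast
          rw [mul_one_div_cancel (by positivity), ENNReal.rpow_one]
  have hi1 : Integrable (fun u => M u * (f (x - t • u) - κ)) volume := by
    refine ⟨(hM.mul hfx).aestronglyMeasurable, hmain.trans_lt ?_⟩
    have : (∫⁻ u, ‖M u‖ₑ ^ (((n:ℝ) + 1) / n)) ^ ((n:ℝ) / (n + 1)) ≠ ⊤ :=
      ENNReal.rpow_ne_top_of_nonneg (by positivity) hq
    finiteness
  have hi2 := (M_integrable hn M hM hs hq).mul_const κ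
  have e : (fun u => M u * f (x - t • u)) = fun u => M u * (f (x - t • u) - κ) + M u * κ := by
    ext u; ring
  refine ⟨by rw [e]; exact hi1.add hi2, fun h0 => ?_⟩
  rw [e, integral_add hi1 hi2, integral_mul_const, h0, zero_mul, add_zero]
  exact (enorm_integral_le_lintegral_enorm _).trans hmain


/-- The dilated average of `f` against `K`. -/
noncomputable def GG (n : ℕ) (K f : EuclideanSpace ℝ (Fin n) → ℝ) (t : ℝ)
    (x : EuclideanSpace ℝ (Fin n)) : ℝ := ∫ u, K u * f (x - t • u)

lemma KerP.integrable {n : ℕ} (hn : 1 ≤ n) {K : EuclideanSpace ℝ (Fin n) → ℝ} {A D β : ℝ}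
    (h : KerP n K A D β) : Integrable K volume :=
  M_integrable hn K h.meas (fun u hu => h.supp u (by linarith)) (h.totq hn).ne

lemma KerP.supp_diff {n : ℕ} {K : EuclideanSpace ℝ (Fin n) → ℝ} {A D β : ℝ}
    (h : KerP n K A D β) (η : EuclideanSpace ℝ (Fin n)) (hη : ‖η‖ ≤ 1) (u : EuclideanSpace ℝ (Fin n))
    (hu : 2 < ‖u‖) : K (u - η) - K u = 0 := by
  have := norm_add_le (u - η) η
  rw [sub_add_cancel] at this
  rw [h.supp u (by linarith), h.supp (u - η) (by linarith), sub_zero]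

lemma G_ab (n : ℕ) (hn : 1 ≤ n) (K : EuclideanSpace ℝ (Fin n) → ℝ) (A D β : ℝ)
    (hβ0 : 0 < β) (hβ1 : β < 1) (h : KerP n K A D β) (h0 : ∫ u, K u = 0) :
    ∃ C : ℝ≥0∞, C ≠ ⊤ ∧ ∀ (f : EuclideanSpace ℝ (Fin n) → ℝ)
    (_ : Measurable f) (a : EuclideanSpace ℝ (Fin n) → ℝ → ℝ) (N : ℝ≥0∞), N ≠ ⊤ → OscBd n f a 1 N →
    ∀ t : ℝ, 0 < t → ∀ x : EuclideanSpace ℝ (Fin n), Integrable (fun u => K u * f (x - t • u)) volume ∧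
      ‖GG n K f t x‖ₑ ≤ C * N ∧
      ∀ x' : EuclideanSpace ℝ (Fin n), ‖x - x'‖ ≤ t → ‖GG n K f t x' - GG n K f t x‖ₑ ≤ C * N *
        ENNReal.ofReal ((‖x - x'‖ / t) ^ (β / (4 * n ^ 2) * (n / (n + 1)))) := by
  have hn0 : (0:ℝ) < n := by exact_mod_cast hn
  obtain ⟨P, hP, hpair⟩ := pairing n hn
  obtain ⟨Q, hQ, hmod⟩ := h.modq hn hβ0 hβ1
  have hKi := h.integrable hn
  set S := (∫⁻ u, ‖K u‖ₑ ^ (((n:ℝ) + 1) / n)) ^ ((n:ℝ) / (n + 1)) with hS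
  have hSf : S ≠ ⊤ := ENNReal.rpow_ne_top_of_nonneg (by positivity) (h.totq hn).ne
  set Q' := Q ^ ((n:ℝ) / (n + 1)) with hQ'
  have hQf : Q' ≠ ⊤ := ENNReal.rpow_ne_top_of_nonneg (by positivity) hQ
  refine ⟨P * (S + Q'), by finiteness, ?_⟩
  intro f hf a N hN hosc t ht x
  have hb := hpair f hf a N hN hosc
  have hsK : ∀ u, 2 < ‖u‖ → K u = 0 := fun u hu => h.supp u (by linarith)
  obtain ⟨hx1, hx2⟩ := hb K h.meas hsK (h.totq hn).ne t ht x
  refine ⟨hx1, ?_, ?_⟩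
  · refine (hx2 h0).trans ?_
    calc P * N * S ≤ P * N * (S + Q') := by gcongr; exact le_self_add
      _ = _ := by ring
  · intro x' hxx
    set η := t⁻¹ • (x - x') with hη
    have hηn : ‖η‖ = ‖x - x'‖ / t := by
      rw [hη, norm_smul, norm_inv, Real.norm_eq_abs, abs_of_pos ht]; field_simp
    have hη1 : ‖η‖ ≤ 1 := by rw [hηn, div_le_one ht]; exact hxx
    have e1 : GG n K f t x' = ∫ u, K (u - η) * f (x - t • u) := by
      unfold GG
      rw [← integral_sub_right_eq_self (fun u => K u * f (x' - t • u)) η]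
      congr 1; ext u
      congr 2
      rw [hη, smul_sub, smul_inv_smul₀ ht.ne']; abel
    have hMm : Measurable fun u => K (u - η) - K u := (h.meas.comp (measurable_id.sub_const η)).sub h.meas
    have hMq := hmod η hη1
    have hMf : ∫⁻ u, ‖K (u - η) - K u‖ₑ ^ (((n:ℝ) + 1) / n) ≠ ⊤ := (hMq.trans_lt (by finiteness)).ne
    obtain ⟨hy1, hy2⟩ := hb (fun u => K (u - η) - K u) hMm (h.supp_diff η hη1) hMf t ht x
    have hM0 : ∫ u, (K (u - η) - K u) = 0 := by
      rw [integral_sub (hKi.comp_sub_right η) hKi, integral_sub_right_eq_self K η, sub_self]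
    have e2 : (fun u => K (u - η) * f (x - t • u)) =
        fun u => (K (u - η) - K u) * f (x - t • u) + K u * f (x - t • u) := by ext u; ring
    have e3 : GG n K f t x' - GG n K f t x = ∫ u, (K (u - η) - K u) * f (x - t • u) := by
      rw [e1, e2, integral_add hy1 hx1]; unfold GG; ring
    rw [e3]
    refine (hy2 hM0).trans ?_
    calc _ ≤ P * N * (Q * ENNReal.ofReal (‖η‖ ^ (β / (4 * n ^ 2)))) ^ ((n:ℝ) / (n + 1)) := by gcongr
      _ = P * N * (Q' * ENNReal.ofReal ((‖x - x'‖ / t) ^ (β / (4 * n ^ 2) * (n / (n + 1))))) := by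
          rw [ENNReal.mul_rpow_of_nonneg _ _ (by positivity),
            ENNReal.ofReal_rpow_of_nonneg (by positivity) (by positivity), ← Real.rpow_mul (norm_nonneg _), hηn]
      _ ≤ P * N * ((S + Q') * ENNReal.ofReal ((‖x - x'‖ / t) ^ (β / (4 * n ^ 2) * (n / (n + 1))))) := by
          gcongr; exact le_add_self
      _ = _ := by ring

lemma T_meas' (n : ℕ) (K g : EuclideanSpace ℝ (Fin n) → ℝ) (hK : Measurable K) (hg : Measurable g) :
    Measurable (fun q : EuclideanSpace ℝ (Fin n) × ℝ => ∫ u, K u * g (q.1 - q.2 • u)) := by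
  have h := (T_meas n K g hK hg).comp (measurable_swap (α := EuclideanSpace ℝ (Fin n)) (β := ℝ))
  simpa only [Function.comp_def, Prod.fst_swap, Prod.snd_swap] using h

lemma swap_sq (n : ℕ) (H : EuclideanSpace ℝ (Fin n) → ℝ → ℝ)
    (hH : Measurable (fun q : EuclideanSpace ℝ (Fin n) × ℝ => H q.1 q.2)) :
    ∫⁻ x, ∫⁻ t in Set.Ioi (0:ℝ), ‖H x t‖ₑ ^ 2 * ENNReal.ofReal (1 / t) =
    ∫⁻ t in Set.Ioi (0:ℝ), (∫⁻ x, ‖H x t‖ₑ ^ 2) * ENNReal.ofReal (1 / t) := by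
  have h3 : Measurable (fun q : EuclideanSpace ℝ (Fin n) × ℝ => ENNReal.ofReal (1 / q.2)) := by
    fun_prop
  have h4 : AEMeasurable (Function.uncurry fun (x : EuclideanSpace ℝ (Fin n)) (t : ℝ) => ‖H x t‖ₑ ^ 2 * ENNReal.ofReal (1 / t))
      (volume.prod (volume.restrict (Set.Ioi (0:ℝ)))) :=
    ((hH.enorm.pow_const 2).mul h3).aemeasurable
  rw [lintegral_lintegral_swap h4]
  refine lintegral_congr fun t => ?_
  rw [lintegral_mul_const' _ _ ENNReal.ofReal_ne_top]

set_option maxHeartbeats 400000 in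
lemma G_c (n : ℕ) (hn : 1 ≤ n) (K : EuclideanSpace ℝ (Fin n) → ℝ) (A D β : ℝ)
    (hβ0 : 0 < β) (hβ1 : β < 1) (h : KerP n K A D β) (h0 : ∫ u, K u = 0) :
    ∃ C : ℝ≥0∞, C ≠ ⊤ ∧ ∀ (f : EuclideanSpace ℝ (Fin n) → ℝ)
    (_ : Measurable f) (a : EuclideanSpace ℝ (Fin n) → ℝ → ℝ) (N : ℝ≥0∞), N ≠ ⊤ → OscBd n f a 1 N →
    ∀ (c : EuclideanSpace ℝ (Fin n)) (r : ℝ), 0 < r →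
    ∫⁻ x in closedBall c r, ∫⁻ t in Set.Ioc (0:ℝ) r, ‖GG n K f t x‖ₑ ^ 2 * ENNReal.ofReal (1 / t) ≤
      C * N ^ 2 * volume (closedBall c r) := by
  have hn0 : (0:ℝ) < n := by exact_mod_cast hn
  obtain ⟨Q, hQ, hmod⟩ := h.modq hn hβ0 hβ1
  obtain ⟨J, hJ, hjn⟩ := jn n 2 (by norm_num)
  obtain ⟨C', hC', hab⟩ := G_ab n hn K A D β hβ0 hβ1 h h0
  have hKi := h.integrable hn
  set V := volume (closedBall (0 : EuclideanSpace ℝ (Fin n)) 2) with hV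
  have hVf : V ≠ ⊤ := vol_fin n 0 2
  set Q' := Q ^ ((n:ℝ) / (n + 1)) * V ^ (1 / ((n:ℝ) + 1)) with hQ'
  have hQf : Q' ≠ ⊤ := by
    have : Q ^ ((n:ℝ) / (n + 1)) ≠ ⊤ := ENNReal.rpow_ne_top_of_nonneg (by positivity) hQ
    have : V ^ (1 / ((n:ℝ) + 1)) ≠ ⊤ := ENNReal.rpow_ne_top_of_nonneg (by positivity) hVf
    finiteness
  have hmod1 : ∀ η : EuclideanSpace ℝ (Fin n), ‖η‖ ≤ 1 →
      ∫⁻ u, ‖K (u - η) - K u‖ₑ ≤ ENNReal.ofReal (Q'.toReal * ‖η‖ ^ (β / (4 * n ^ 2) * (n / (n + 1)))) := by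
    intro η hη
    have hMm : Measurable fun u => K (u - η) - K u := (h.meas.comp (measurable_id.sub_const η)).sub h.meas
    refine (M_int hn _ hMm (h.supp_diff η hη)).trans ?_
    rw [ENNReal.ofReal_mul ENNReal.toReal_nonneg, ENNReal.ofReal_toReal hQf]
    calc _ ≤ (Q * ENNReal.ofReal (‖η‖ ^ (β / (4 * n ^ 2)))) ^ ((n:ℝ) / (n + 1)) * V ^ (1 / ((n:ℝ) + 1)) := by
          gcongr; exact hmod η hη
      _ = _ := by
          rw [ENNReal.mul_rpow_of_nonneg _ _ (by positivity),
            ENNReal.ofReal_rpow_of_nonneg (by positivity) (by positivity), ← Real.rpow_mul (norm_nonneg _)]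
          ring
  obtain ⟨Cs, hCs, hsq⟩ := sq_fun n K h.meas hKi h.supp h0 Q'.toReal (β / (4 * n ^ 2) * (n / (n + 1)))
    ENNReal.toReal_nonneg (by positivity) hmod1 hn
  refine ⟨Cs * J * ENNReal.ofReal (2 ^ n), by finiteness, ?_⟩
  intro f hf a N hN hosc c r hr
  set κ := a c (2 * r) with hκ
  have hJN := hjn f hf.aemeasurable a N hN hosc c (2 * r) (by positivity)
  have h1N := hosc c (2 * r) (by positivity)
  rw [vol_closedBall_mul n c c (by norm_num) hr.le] at hJN h1N
  have hvf := vol_fin n c r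
  set g : EuclideanSpace ℝ (Fin n) → ℝ := (closedBall c (2 * r)).indicator (fun y => f y - κ) with hg
  have hgm : Measurable g := (hf.sub_const κ).indicator measurableSet_closedBall
  have hgp : ∀ p : ℕ, p ≠ 0 → ∫⁻ x, ‖g x‖ₑ ^ p = ∫⁻ x in closedBall c (2 * r), ‖f x - κ‖ₑ ^ p := by
    intro p hp
    rw [← lintegral_indicator measurableSet_closedBall]
    congr 1; ext x
    by_cases hx : x ∈ closedBall c (2 * r)
    · simp [hg, Set.indicator_of_mem hx]
    · simp [hg, Set.indicator_of_notMem hx, hp]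
  have hg1 : Integrable g volume := by
    refine ⟨hgm.aestronglyMeasurable, ?_⟩
    have := hgp 1 one_ne_zero
    simp only [pow_one] at this h1N
    rw [HasFiniteIntegral, this]
    exact h1N.trans_lt (by finiteness)
  have hg2 : MemLp g 2 volume := by
    refine ⟨hgm.aestronglyMeasurable, ?_⟩
    rw [eLpNorm_lt_top_iff_lintegral_rpow_enorm_lt_top (by norm_num) (by norm_num)]
    have := hgp 2 two_ne_zero
    simp only [ENNReal.toReal_ofNat, ENNReal.rpow_ofNat]
    rw [this]
    exact hJN.trans_lt (by finiteness)
  have hTm := T_meas' n K g h.meas hgm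
  have hrep : ∀ x ∈ closedBall c r, ∀ t ∈ Set.Ioc (0:ℝ) r, GG n K f t x = ∫ u, K u * g (x - t • u) := by
    intro x hx t ht
    have hi := (hab f hf a N hN hosc t ht.1 x).1
    have e : (fun u => K u * g (x - t • u)) = fun u => K u * f (x - t • u) - K u * κ := by
      ext u
      by_cases hu : ‖u‖ ≤ 1
      · have : x - t • u ∈ closedBall c (2 * r) := by
          rw [mem_closedBall, dist_eq_norm] at hx ⊢
          have h1 : ‖t • u‖ ≤ r := by
            rw [norm_smul, Real.norm_eq_abs, abs_of_pos ht.1]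
            have := ht.1
            have := ht.2
            nlinarith [norm_nonneg u]
          calc ‖x - t • u - c‖ = ‖(x - c) - t • u‖ := by congr 1; abel
            _ ≤ _ := norm_sub_le _ _
            _ ≤ _ := by linarith
        simp only [hg, Set.indicator_of_mem this]; ring
      · rw [h.supp u (not_le.1 hu)]; ring
    rw [e, integral_sub hi (hKi.mul_const κ), integral_mul_const, h0]
    simp [GG]
  calc _ = ∫⁻ x in closedBall c r, ∫⁻ t in Set.Ioc (0:ℝ) r, ‖∫ u, K u * g (x - t • u)‖ₑ ^ 2 * ENNReal.ofReal (1 / t) := by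
        apply setLIntegral_congr_fun measurableSet_closedBall
        intro x hx
        apply setLIntegral_congr_fun measurableSet_Ioc
        intro t ht
        simp only
        rw [hrep x hx t ht]
    _ ≤ ∫⁻ x, ∫⁻ t in Set.Ioi (0:ℝ), ‖∫ u, K u * g (x - t • u)‖ₑ ^ 2 * ENNReal.ofReal (1 / t) := by
        refine (setLIntegral_le_lintegral _ _).trans ?_
        apply lintegral_mono
        intro x
        exact lintegral_mono_set (fun t ht => ht.1)
    _ = ∫⁻ t in Set.Ioi (0:ℝ), (∫⁻ x, ‖∫ u, K u * g (x - t • u)‖ₑ ^ 2) * ENNReal.ofReal (1 / t) :=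
        swap_sq n (fun x t => ∫ u, K u * g (x - t • u)) hTm
    _ ≤ Cs * ∫⁻ x, ‖g x‖ₑ ^ 2 := hsq g hgm hg1 hg2
    _ ≤ Cs * (J * N ^ 2 * (ENNReal.ofReal (2 ^ n) * volume (closedBall c r))) := by
        rw [hgp 2 two_ne_zero]; gcongr
    _ = _ := by ring


/-- Weighted square integral over a set of scales. -/
noncomputable def II (n : ℕ) (F : ℝ → EuclideanSpace ℝ (Fin n) → ℝ) (s : Set ℝ)
    (x : EuclideanSpace ℝ (Fin n)) : ℝ≥0∞ :=
  ∫⁻ t in s, ‖F t x‖ₑ ^ 2 * ENNReal.ofReal (1 / t)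

lemma II_meas (n : ℕ) (F : ℝ → EuclideanSpace ℝ (Fin n) → ℝ) (s : Set ℝ)
    (hF : Measurable (fun q : EuclideanSpace ℝ (Fin n) × ℝ => F q.2 q.1)) : Measurable (II n F s) := by
  have h3 : Measurable (fun q : EuclideanSpace ℝ (Fin n) × ℝ => ENNReal.ofReal (1 / q.2)) := by
    fun_prop
  exact Measurable.lintegral_prod_right' (ν := volume.restrict s) ((hF.enorm.pow_const 2).mul h3)

lemma enorm_toReal_sub_le (a b d : ℝ≥0∞) (ha : a ≠ ⊤) (hb : b ≠ ⊤) (h1 : a ≤ b + d) (h2 : b ≤ a + d) :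
    ‖a.toReal - b.toReal‖ₑ ≤ d := by
  by_cases hd : d = ⊤
  · simp [hd]
  · lift a to NNReal using ha
    lift b to NNReal using hb
    lift d to NNReal using hd
    have h1' : a ≤ b + d := by exact_mod_cast h1
    have h2' : b ≤ a + d := by exact_mod_cast h2
    have h1r : (a:ℝ) ≤ b + d := by exact_mod_cast h1'
    have h2r : (b:ℝ) ≤ a + d := by exact_mod_cast h2'
    simp only [ENNReal.coe_toReal]
    rw [Real.enorm_eq_ofReal_abs, ← ENNReal.ofReal_coe_nnreal]
    apply ENNReal.ofReal_le_ofReal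
    rw [abs_le]; constructor <;> linarith

lemma bmo_of (n : ℕ) (g : EuclideanSpace ℝ (Fin n) → ℝ) (hg : Measurable g) (c : EuclideanSpace ℝ (Fin n))
    (r : ℝ) (hr : 0 < r) (κ : ℝ) (D : ℝ≥0∞) (hD : D ≠ ⊤)
    (h : ∫⁻ x in closedBall c r, ‖g x - κ‖ₑ ≤ D * volume (closedBall c r)) :
    ENNReal.ofReal ((volume (closedBall c r)).toReal⁻¹ *
      ∫ y in closedBall c r, |g y - ballAvg n g c r|) ≤ 2 * D := by
  have hv0 := vol_pos n c hr
  have hvf := vol_fin n c r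
  set V := volume (closedBall c r) with hV
  have hVr : 0 < V.toReal := ENNReal.toReal_pos hv0 hvf
  have hi : IntegrableOn (fun x => g x - κ) (closedBall c r) volume :=
    ⟨(hg.sub_const κ).aestronglyMeasurable, h.trans_lt (by finiteness)⟩
  have hc : ∀ q : ℝ, IntegrableOn (fun _ : EuclideanSpace ℝ (Fin n) => q) (closedBall c r) volume :=
    fun q => integrableOn_const hvf
  have hgi : IntegrableOn g (closedBall c r) volume := by
    refine (hi.add (hc κ)).congr_fun (fun x _ => ?_) measurableSet_closedBall
    simp
  set av := ballAvg n g c r with hav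
  have e1 : av - κ = V.toReal⁻¹ * ∫ x in closedBall c r, (g x - κ) := by
    rw [integral_sub hgi (hc κ), hav, ballAvg]
    simp only [integral_const, measureReal_restrict_apply_univ, smul_eq_mul]
    rw [Measure.real, ← hV]
    field_simp
  have e2 : ‖av - κ‖ₑ ≤ D := by
    rw [e1, enorm_mul]
    have h1 : ‖V.toReal⁻¹‖ₑ = V⁻¹ := by
      rw [Real.enorm_eq_ofReal (by positivity), ENNReal.ofReal_inv_of_pos hVr, ENNReal.ofReal_toReal hvf]
    rw [h1]
    calc _ ≤ V⁻¹ * (D * V) := by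
          gcongr
          exact (enorm_integral_le_lintegral_enorm _).trans h
      _ = D * (V⁻¹ * V) := by ring
      _ = D := by rw [ENNReal.inv_mul_cancel hv0 hvf, mul_one]
  have hga : IntegrableOn (fun x => g x - av) (closedBall c r) volume := hgi.sub (hc av)
  have e3 : ENNReal.ofReal (∫ y in closedBall c r, |g y - av|) ≤ 2 * D * V := by
    have := ofReal_integral_norm_eq_lintegral_enorm hga
    simp only [Real.norm_eq_abs] at this
    rw [this]
    calc ∫⁻ x in closedBall c r, ‖g x - av‖ₑ ≤ ∫⁻ x in closedBall c r, (‖g x - κ‖ₑ + D) := by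
          apply lintegral_mono
          intro x
          have : g x - av = (g x - κ) - (av - κ) := by ring
          simp only
          rw [this]
          exact enorm_sub_le.trans (by gcongr)
      _ = (∫⁻ x in closedBall c r, ‖g x - κ‖ₑ) + D * V := by
          rw [lintegral_add_right _ measurable_const, setLIntegral_const]
      _ ≤ D * V + D * V := by gcongr
      _ = _ := by ring
  rw [ENNReal.ofReal_mul (by positivity), ENNReal.ofReal_inv_of_pos hVr, ENNReal.ofReal_toReal hvf]
  calc _ ≤ V⁻¹ * (2 * D * V) := by gcongr
    _ = 2 * D * (V⁻¹ * V) := by ring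
    _ = _ := by rw [ENNReal.inv_mul_cancel hv0 hvf, mul_one]

lemma tail_cmp (n : ℕ) (F : ℝ → EuclideanSpace ℝ (Fin n) → ℝ)
    (hF : Measurable (fun q : EuclideanSpace ℝ (Fin n) × ℝ => F q.2 q.1)) (M : ℝ≥0∞) (δ : ℝ) (hδ : 0 < δ)
    (hM : M ≠ ⊤)
    (hb : ∀ t : ℝ, 0 < t → ∀ x x' : EuclideanSpace ℝ (Fin n), ‖x - x'‖ ≤ t →
      ‖F t x' - F t x‖ₑ ≤ M * ENNReal.ofReal ((‖x - x'‖ / t) ^ δ))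
    (r : ℝ) (hr : 0 < r) (x x' : EuclideanSpace ℝ (Fin n)) (hx : ‖x - x'‖ ≤ r) :
    (II n F (Set.Ioi r) x') ^ (1 / 2 : ℝ) ≤ (II n F (Set.Ioi r) x) ^ (1 / 2 : ℝ) +
      M * ENNReal.ofReal (1 / (2 * δ)) ^ (1 / 2 : ℝ) := by
  set w : ℝ → ℝ≥0∞ := fun t => ENNReal.ofReal (1 / t) ^ (1 / 2 : ℝ) with hw
  have hw2 : ∀ t, (w t) ^ 2 = ENNReal.ofReal (1 / t) := by
    intro t
    rw [hw, ← ENNReal.rpow_natCast, ← ENNReal.rpow_mul]; norm_num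
  have hwm : Measurable w := by fun_prop
  set u : ℝ → ℝ≥0∞ := fun t => ‖F t x‖ₑ * w t with hu
  set v : ℝ → ℝ≥0∞ := fun t => M * ENNReal.ofReal ((r / t) ^ δ) * w t with hv
  have hum : Measurable u := by
    have h1 : Measurable fun t : ℝ => F t x := hF.comp (measurable_const.prodMk measurable_id)
    exact h1.enorm.mul hwm
  have hvm : Measurable v := by
    have : Measurable fun t : ℝ => (r / t) ^ δ := by fun_prop
    exact (this.ennreal_ofReal.const_mul M).mul hwm
  have key := ENNReal.lintegral_Lp_add_le (μ := volume.restrict (Set.Ioi r)) hum.aemeasurable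
    hvm.aemeasurable (p := 2) (by norm_num)
  have e1 : ∫⁻ t in Set.Ioi r, u t ^ (2:ℝ) = II n F (Set.Ioi r) x := by
    unfold II
    refine lintegral_congr fun t => ?_
    rw [ENNReal.rpow_ofNat, hu, mul_pow, hw2]
  have e2 : ∫⁻ t in Set.Ioi r, v t ^ (2:ℝ) = M ^ 2 * ENNReal.ofReal (1 / (2 * δ)) := by
    rw [← tail_lint r δ hr hδ, ← lintegral_const_mul' _ _ (by finiteness)]
    apply setLIntegral_congr_fun measurableSet_Ioi
    intro t ht
    have ht0 : 0 < t := hr.trans ht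
    simp only
    rw [ENNReal.rpow_ofNat, hv, mul_pow, hw2, mul_pow, mul_assoc, ← ENNReal.ofReal_pow (by positivity),
      ← ENNReal.ofReal_mul (by positivity), ← Real.rpow_natCast, ← Real.rpow_mul (by positivity)]
    congr 2
    push_cast
    rw [mul_comm δ 2]; ring
  rw [e1, e2, ENNReal.mul_rpow_of_nonneg _ _ (by norm_num), ← ENNReal.rpow_natCast, ← ENNReal.rpow_mul] at key
  norm_num at key
  norm_num
  refine le_trans ?_ key
  gcongr
  unfold II
  apply setLIntegral_mono' measurableSet_Ioi
  intro t ht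
  have ht0 : 0 < t := hr.trans ht
  rw [← hw2, ← mul_pow]
  gcongr
  rw [hu, hv]
  simp only
  rw [← add_mul]
  gcongr
  have : F t x' = F t x + (F t x' - F t x) := by ring
  rw [this]
  refine (enorm_add_le _ _).trans ?_
  gcongr
  refine (hb t ht0 x x' (hx.trans ht.le)).trans ?_
  gcongr

lemma tail_fin (n : ℕ) (F : ℝ → EuclideanSpace ℝ (Fin n) → ℝ)
    (hF : Measurable (fun q : EuclideanSpace ℝ (Fin n) × ℝ => F q.2 q.1)) (M : ℝ≥0∞) (δ : ℝ) (hδ : 0 < δ)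
    (hM : M ≠ ⊤)
    (ha : ∀ t : ℝ, 0 < t → ∀ x : EuclideanSpace ℝ (Fin n), ‖F t x‖ₑ ≤ M)
    (hb : ∀ t : ℝ, 0 < t → ∀ x x' : EuclideanSpace ℝ (Fin n), ‖x - x'‖ ≤ t →
      ‖F t x' - F t x‖ₑ ≤ M * ENNReal.ofReal ((‖x - x'‖ / t) ^ δ))
    (x₀ : EuclideanSpace ℝ (Fin n)) (h0 : II n F (Set.Ioi 0) x₀ ≠ ⊤)
    (r : ℝ) (hr : 0 < r) (x : EuclideanSpace ℝ (Fin n)) : II n F (Set.Ioi r) x ≠ ⊤ := by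
  set R := max r ‖x₀ - x‖ with hR
  have hrR : r ≤ R := le_max_left _ _
  have hR0 : 0 < R := hr.trans_le hrR
  have h1 : II n F (Set.Ioi R) x₀ ≠ ⊤ :=
    ((lintegral_mono_set (Set.Ioi_subset_Ioi hR0.le)).trans_lt h0.lt_top).ne
  have h2 : II n F (Set.Ioi R) x ≠ ⊤ := by
    have h3 := tail_cmp n F hF M δ hδ hM hb R hR0 x₀ x (le_max_right _ _)
    intro h4
    rw [h4, ENNReal.top_rpow_of_pos (by norm_num), top_le_iff] at h3
    have : (II n F (Set.Ioi R) x₀) ^ (1 / 2 : ℝ) ≠ ⊤ := ENNReal.rpow_ne_top_of_nonneg (by norm_num) h1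
    have : ENNReal.ofReal (1 / (2 * δ)) ^ (1 / 2 : ℝ) ≠ ⊤ := ENNReal.rpow_ne_top_of_nonneg (by norm_num) (by finiteness)
    exact absurd h3 (by finiteness)
  have h5 : II n F (Set.Ioi r) x ≤ II n F (Set.Ioc r R) x + II n F (Set.Ioi R) x := by
    unfold II
    rw [← Set.Ioc_union_Ioi_eq_Ioi hrR]
    exact lintegral_union_le _ _ _
  have h6 : II n F (Set.Ioc r R) x ≤ M ^ 2 * ENNReal.ofReal (1 / r) * ENNReal.ofReal (R - r) := by
    unfold II
    calc _ ≤ ∫⁻ t in Set.Ioc r R, M ^ 2 * ENNReal.ofReal (1 / r) := by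
          apply setLIntegral_mono' measurableSet_Ioc
          intro t ht
          have ht0 : 0 < t := hr.trans ht.1
          gcongr
          · exact ha t ht0 x
          · exact ht.1.le
      _ = _ := by rw [setLIntegral_const, Real.volume_Ioc]
  refine (h5.trans_lt ?_).ne
  exact ENNReal.add_lt_top.2 ⟨h6.trans_lt (by finiteness), h2.lt_top⟩

lemma assemble (n : ℕ) (F : ℝ → EuclideanSpace ℝ (Fin n) → ℝ)
    (hF : Measurable (fun q : EuclideanSpace ℝ (Fin n) × ℝ => F q.2 q.1)) (M : ℝ≥0∞) (δ : ℝ) (hδ : 0 < δ)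
    (hM : M ≠ ⊤)
    (ha : ∀ t : ℝ, 0 < t → ∀ x : EuclideanSpace ℝ (Fin n), ‖F t x‖ₑ ≤ M)
    (hb : ∀ t : ℝ, 0 < t → ∀ x x' : EuclideanSpace ℝ (Fin n), ‖x - x'‖ ≤ t →
      ‖F t x' - F t x‖ₑ ≤ M * ENNReal.ofReal ((‖x - x'‖ / t) ^ δ))
    (hc : ∀ (c : EuclideanSpace ℝ (Fin n)) (r : ℝ), 0 < r →
      ∫⁻ x in closedBall c r, II n F (Set.Ioc 0 r) x ≤ M ^ 2 * volume (closedBall c r))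
    (x₀ : EuclideanSpace ℝ (Fin n)) (h0 : II n F (Set.Ioi 0) x₀ ≠ ⊤) :
    (∀ᵐ x : EuclideanSpace ℝ (Fin n), (II n F (Set.Ioi 0) x) ^ (1 / 2 : ℝ) < ⊤) ∧
    bmoNorm n (fun x => ((II n F (Set.Ioi 0) x) ^ (1 / 2 : ℝ)).toReal) ≤
      2 * (M + M * ENNReal.ofReal (1 / (2 * δ)) ^ (1 / 2 : ℝ)) := by
  have hsplit : ∀ r : ℝ, 0 < r → ∀ x, II n F (Set.Ioi 0) x ≤ II n F (Set.Ioc 0 r) x + II n F (Set.Ioi r) x := by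
    intro r hr x
    unfold II
    rw [← Set.Ioc_union_Ioi_eq_Ioi hr.le]
    exact lintegral_union_le _ _ _
  have hfin := tail_fin n F hF M δ hδ hM ha hb x₀ h0
  have hae : ∀ᵐ x : EuclideanSpace ℝ (Fin n), II n F (Set.Ioi 0) x < ⊤ := by
    have h1 : ∀ k : ℕ, ∀ᵐ x : EuclideanSpace ℝ (Fin n), x ∈ closedBall (0 : EuclideanSpace ℝ (Fin n)) ((k:ℝ) + 1) →
        II n F (Set.Ioi 0) x < ⊤ := by
      intro k
      have hk : (0:ℝ) < k + 1 := by positivity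
      rw [← ae_restrict_iff' measurableSet_closedBall]
      have hv := vol_fin n (0 : EuclideanSpace ℝ (Fin n)) ((k:ℝ) + 1)
      have h2 := ae_lt_top (μ := volume.restrict (closedBall (0 : EuclideanSpace ℝ (Fin n)) ((k:ℝ) + 1)))
        (II_meas n F (Set.Ioc 0 ((k:ℝ) + 1)) hF) ((hc 0 (k + 1) hk).trans_lt (by finiteness)).ne
      filter_upwards [h2] with x hx
      exact (hsplit _ hk x).trans_lt (ENNReal.add_lt_top.2 ⟨hx, (hfin _ hk x).lt_top⟩)
    filter_upwards [ae_all_iff.2 h1] with x hx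
    obtain ⟨k, hk⟩ := exists_nat_ge ‖x‖
    exact hx k (by rw [mem_closedBall, dist_zero_right]; linarith)
  have hae2 : ∀ᵐ x : EuclideanSpace ℝ (Fin n), (II n F (Set.Ioi 0) x) ^ (1 / 2 : ℝ) < ⊤ := by
    filter_upwards [hae] with x hx
    exact ENNReal.rpow_lt_top_of_nonneg (by norm_num) hx.ne
  refine ⟨hae2, ?_⟩
  set L := ENNReal.ofReal (1 / (2 * δ)) ^ (1 / 2 : ℝ) with hL
  have hLf : L ≠ ⊤ := ENNReal.rpow_ne_top_of_nonneg (by norm_num) (by finiteness)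
  unfold bmoNorm
  refine iSup_le fun c => iSup_le fun r => iSup_le fun hr => ?_
  refine bmo_of n _ ((II_meas n F _ hF).pow_const _).ennreal_toReal c r hr
    (((II n F (Set.Ioi r) c) ^ (1 / 2 : ℝ)).toReal) _ (by finiteness) ?_
  set U : EuclideanSpace ℝ (Fin n) → ℝ≥0∞ := fun x => (II n F (Set.Ioc 0 r) x) ^ (1 / 2 : ℝ) with hU
  have hUm : Measurable U := (II_meas n F _ hF).pow_const _
  have hvf := vol_fin n c r
  have hUi : ∫⁻ x in closedBall c r, U x ≤ M * volume (closedBall c r) := by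
    have h1 := cs_ker (volume.restrict (closedBall c r)) (fun _ => 1) U measurable_const.aemeasurable
      hUm.aemeasurable
    simp only [one_mul] at h1
    rw [setLIntegral_const, one_mul] at h1
    have h2 : ∀ x, U x ^ 2 = II n F (Set.Ioc 0 r) x := by
      intro x
      rw [hU, ← ENNReal.rpow_natCast, ← ENNReal.rpow_mul]; norm_num
    simp only [h2] at h1
    have h3 := h1.trans (mul_le_mul_right (hc c r hr) _)
    have h4 : volume (closedBall c r) * (M ^ 2 * volume (closedBall c r)) = (M * volume (closedBall c r)) ^ 2 := by ring
    rw [h4] at h3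
    exact (ENNReal.pow_le_pow_left_iff two_ne_zero).1 h3
  calc _ ≤ ∫⁻ x in closedBall c r, (U x + M * L) := by
        apply lintegral_mono_ae
        rw [ae_restrict_iff' measurableSet_closedBall]
        filter_upwards [hae2] with x hx hxB
        rw [mem_closedBall, dist_eq_norm] at hxB
        have hxB' : ‖c - x‖ ≤ r := by rwa [norm_sub_rev]
        have t1 := tail_cmp n F hF M δ hδ hM hb r hr x c hxB
        have t2 := tail_cmp n F hF M δ hδ hM hb r hr c x hxB'
        rw [← hL] at t1 t2
        refine enorm_toReal_sub_le _ _ _ hx.ne (ENNReal.rpow_ne_top_of_nonneg (by norm_num) (hfin r hr c)) ?_ ?_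
        · calc _ ≤ (II n F (Set.Ioc 0 r) x + II n F (Set.Ioi r) x) ^ (1 / 2 : ℝ) := by
                gcongr; exact hsplit r hr x
            _ ≤ U x + (II n F (Set.Ioi r) x) ^ (1 / 2 : ℝ) :=
                ENNReal.rpow_add_le_add_rpow _ _ (by norm_num) (by norm_num)
            _ ≤ U x + ((II n F (Set.Ioi r) c) ^ (1 / 2 : ℝ) + M * L) := by gcongr
            _ = _ := by ring
        · calc _ ≤ _ := t1
            _ ≤ (II n F (Set.Ioi 0) x) ^ (1 / 2 : ℝ) + M * L := by
                gcongr
                exact lintegral_mono_set (Set.Ioi_subset_Ioi hr.le)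
            _ ≤ _ := by gcongr; exact le_add_self
    _ = (∫⁻ x in closedBall c r, U x) + M * L * volume (closedBall c r) := by
        rw [lintegral_add_right _ measurable_const, setLIntegral_const]
    _ ≤ M * volume (closedBall c r) + M * L * volume (closedBall c r) := by gcongr
    _ = _ := by ring


lemma osc_rep (n : ℕ) (f f' : EuclideanSpace ℝ (Fin n) → ℝ) (hf : LocallyIntegrable f volume)
    (hff : f =ᵐ[volume] f') : OscBd n f' (ballAvg n f) 1 (bmoNorm n f) := by
  intro c r hr
  have hv0 := vol_pos n c hr
  have hvf := vol_fin n c r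
  have hfi : IntegrableOn f (closedBall c r) volume := hf.integrableOn_isCompact (isCompact_closedBall c r)
  set av := ballAvg n f c r with hav
  have hga : IntegrableOn (fun x => f x - av) (closedBall c r) volume := hfi.sub (integrableOn_const hvf)
  have e1 : ∫⁻ y in closedBall c r, ‖f' y - av‖ₑ ^ 1 = ∫⁻ y in closedBall c r, ‖f y - av‖ₑ := by
    apply lintegral_congr_ae
    filter_upwards [ae_restrict_of_ae hff] with x hx
    rw [hx, pow_one]
  have e2 := ofReal_integral_norm_eq_lintegral_enorm hga
  simp only [Real.norm_eq_abs] at e2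
  have e3 : ENNReal.ofReal ((volume (closedBall c r)).toReal⁻¹ *
      ∫ y in closedBall c r, |f y - av|) ≤ bmoNorm n f :=
    le_iSup_of_le c (le_iSup_of_le r (le_iSup_of_le hr le_rfl))
  rw [e1, ← e2]
  set V := volume (closedBall c r) with hV
  have hVr : 0 < V.toReal := ENNReal.toReal_pos hv0 hvf
  rw [ENNReal.ofReal_mul (by positivity), ENNReal.ofReal_inv_of_pos hVr, ENNReal.ofReal_toReal hvf] at e3
  calc _ = V⁻¹ * ENNReal.ofReal (∫ y in closedBall c r, |f y - av|) * V := by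
        rw [mul_comm, ← mul_assoc, ENNReal.mul_inv_cancel hv0 hvf, one_mul]
    _ ≤ _ := by gcongr

lemma int_rep (n : ℕ) (hn : 1 ≤ n) (Ω f f' : EuclideanSpace ℝ (Fin n) → ℝ)
    (hΩhom : ∀ l : ℝ, 0 < l → ∀ y : EuclideanSpace ℝ (Fin n), Ω (l • y) = Ω y)
    (hff : f =ᵐ[volume] f') (t : ℝ) (ht : 0 < t) (x : EuclideanSpace ℝ (Fin n)) :
    ∫ y in closedBall (0 : EuclideanSpace ℝ (Fin n)) t, Ω y / ‖y‖ ^ ((n : ℝ) - 1) * f (x - y) =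
      t * GG n (mkK n Ω) f' t x := by
  have : Nonempty (Fin n) := ⟨⟨0, hn⟩⟩
  have hmp := Measure.measurePreserving_sub_left (volume : Measure (EuclideanSpace ℝ (Fin n))) x
  have h1 : ∀ᵐ y : EuclideanSpace ℝ (Fin n), f (x - y) = f' (x - y) :=
    hmp.quasiMeasurePreserving.ae hff
  have e1 : ∫ y in closedBall (0 : EuclideanSpace ℝ (Fin n)) t, Ω y / ‖y‖ ^ ((n : ℝ) - 1) * f (x - y) =
      ∫ y, (closedBall (0 : EuclideanSpace ℝ (Fin n)) t).indicator
        (fun y => Ω y / ‖y‖ ^ ((n : ℝ) - 1) * f' (x - y)) y := by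
    rw [integral_indicator measurableSet_closedBall]
    apply integral_congr_ae
    filter_upwards [ae_restrict_of_ae h1] with y hy
    rw [hy]
  rw [e1]
  set H := (closedBall (0 : EuclideanSpace ℝ (Fin n)) t).indicator
        (fun y => Ω y / ‖y‖ ^ ((n : ℝ) - 1) * f' (x - y)) with hH
  have e2 := Measure.integral_comp_smul (volume : Measure (EuclideanSpace ℝ (Fin n))) H t
  rw [finrank_euclideanSpace_fin, abs_of_pos (by positivity), smul_eq_mul] at e2
  have e3 : ∫ y, H y = t ^ n * ∫ u, H (t • u) := by
    rw [e2]; field_simp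
  have e4 : ∫ u, H (t • u) = ∫ u, (t ^ ((n:ℝ) - 1))⁻¹ * (mkK n Ω u * f' (x - t • u)) := by
    apply integral_congr_ae
    have h0 : ∀ᵐ u : EuclideanSpace ℝ (Fin n), u ≠ 0 := by
      simp [ae_iff]
    filter_upwards [h0] with u hu
    have hnorm : ‖t • u‖ = t * ‖u‖ := by rw [norm_smul, Real.norm_eq_abs, abs_of_pos ht]
    by_cases h : ‖u‖ ≤ 1
    · have hm : t • u ∈ closedBall (0 : EuclideanSpace ℝ (Fin n)) t := by
        rw [mem_closedBall, dist_zero_right, hnorm]; nlinarith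
      rw [hH, Set.indicator_of_mem hm, hΩhom t ht, hnorm, Real.mul_rpow ht.le (norm_nonneg _), mkK,
        if_neg (by push Not; exact ⟨hu, h⟩)]
      field_simp
    · have hm : t • u ∉ closedBall (0 : EuclideanSpace ℝ (Fin n)) t := by
        rw [mem_closedBall, dist_zero_right, hnorm]; push Not at h ⊢; nlinarith
      rw [hH, Set.indicator_of_notMem hm, mkK, if_pos (Or.inr (not_le.1 h))]
      ring
  rw [e3, e4, integral_const_mul, GG, Real.rpow_sub_one ht.ne', Real.rpow_natCast]
  field_simp

lemma prod_diff {ι : Type*} (s : Finset ι) (a b : ι → ℝ) (M : ι → ℝ≥0∞) (ρ : ℝ≥0∞)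
    (ha : ∀ j, ‖a j‖ₑ ≤ M j) (hb : ∀ j, ‖b j‖ₑ ≤ M j) (hab : ∀ j, ‖a j - b j‖ₑ ≤ M j * ρ) :
    ‖∏ j ∈ s, a j‖ₑ ≤ ∏ j ∈ s, M j ∧ ‖∏ j ∈ s, a j - ∏ j ∈ s, b j‖ₑ ≤ s.card * (∏ j ∈ s, M j) * ρ := by
  classical
  induction s using Finset.induction_on with
  | empty => simp
  | insert i s hi ih =>
    obtain ⟨h1, h2⟩ := ih
    rw [Finset.prod_insert hi, Finset.prod_insert hi, Finset.prod_insert hi, Finset.card_insert_of_notMem hi]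
    constructor
    · rw [enorm_mul]; gcongr; exact ha i
    · have e : a i * ∏ j ∈ s, a j - b i * ∏ j ∈ s, b j =
          (a i - b i) * ∏ j ∈ s, a j + b i * (∏ j ∈ s, a j - ∏ j ∈ s, b j) := by ring
      rw [e]
      refine (enorm_add_le _ _).trans ?_
      rw [enorm_mul, enorm_mul]
      calc _ ≤ M i * ρ * (∏ j ∈ s, M j) + M i * (s.card * (∏ j ∈ s, M j) * ρ) := by
            gcongr
            · exact hab i
            · exact hb i
        _ = _ := by push_cast; ring



/-- BMO boundedness and a.e. finiteness of the separated
multilinear Marcinkiewicz integral. -/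
theorem stmt14 (n m : ℕ) (hn : 1 ≤ n) (hm : 1 ≤ m)
    (Ω : Fin m → EuclideanSpace ℝ (Fin n) → ℝ)
    (β C₀ : ℝ) (hβ0 : 0 < β) (hβ1 : β < 1) (hC₀ : 0 < C₀)
    (hΩhom : ∀ (j : Fin m) (l : ℝ), 0 < l → ∀ y : EuclideanSpace ℝ (Fin n),
      Ω j (l • y) = Ω j y)
    (hΩlip : ∀ (j : Fin m) (ξ η : EuclideanSpace ℝ (Fin n)), ξ ≠ 0 → η ≠ 0 →
      |Ω j ξ - Ω j η| ≤ C₀ * ‖‖ξ‖⁻¹ • ξ - ‖η‖⁻¹ • η‖ ^ β)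
    (hΩvan : ∀ j : Fin m,
      ∫ z : sphere (0 : EuclideanSpace ℝ (Fin n)) 1, Ω j (z : EuclideanSpace ℝ (Fin n))
        ∂(volume : Measure (EuclideanSpace ℝ (Fin n))).toSphere = 0)
    :
    ∃ C > (0 : ℝ), ∀ f : Fin m → EuclideanSpace ℝ (Fin n) → ℝ,
      (∀ j, LocallyIntegrable (f j) volume) →
      (∀ j, bmoNorm n (f j) < ⊤) →
      ∀ x₀ : EuclideanSpace ℝ (Fin n), smarc n m Ω f x₀ < ⊤ →
        (∀ᵐ x : EuclideanSpace ℝ (Fin n), smarc n m Ω f x < ⊤) ∧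
        bmoNorm n (fun x => (smarc n m Ω f x).toReal) ≤
          ENNReal.ofReal C * ∏ j, bmoNorm n (f j) := by
  have hn0 : (0:ℝ) < n := by exact_mod_cast hn
  have hker : ∀ j, ∃ A D, KerP n (mkK n (Ω j)) A D β := fun j =>
    mkK_KerP n hn (Ω j) β C₀ hβ0 hβ1 hC₀ (hΩlip j)
  choose A D hK using hker
  have hK0 : ∀ j, ∫ u, mkK n (Ω j) u = 0 := fun j => mkK_int n (Ω j) (hΩhom j) (hΩvan j) hn
  choose Ca hCa hab using fun j => G_ab n hn (mkK n (Ω j)) (A j) (D j) β hβ0 hβ1 (hK j) (hK0 j)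
  let j₀ : Fin m := ⟨0, hm⟩
  obtain ⟨Cc, hCc, hcc⟩ := G_c n hn (mkK n (Ω j₀)) (A j₀) (D j₀) β hβ0 hβ1 (hK j₀) (hK0 j₀)
  set δ : ℝ := β / (4 * n ^ 2) * (n / (n + 1)) with hδ
  have hδ0 : 0 < δ := by positivity
  set Pa := ∏ j, Ca j with hPa
  set Pe := ∏ j ∈ Finset.univ.erase j₀, Ca j with hPe
  have hPaf : Pa ≠ ⊤ := ENNReal.prod_ne_top fun j _ => hCa j
  have hPef : Pe ≠ ⊤ := ENNReal.prod_ne_top fun j _ => hCa j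
  set T : ℝ≥0∞ := (m + 1) * Pa + Cc * Pe ^ 2 + 1 with hT
  have hTf : T ≠ ⊤ := by finiteness
  have hT1 : Pa ≤ T := by
    calc Pa = 1 * Pa := (one_mul _).symm
      _ ≤ (m + 1) * Pa := by gcongr; exact le_add_self
      _ ≤ T := by rw [hT, add_assoc]; exact le_self_add
  have hT2 : m * Pa ≤ T := by
    calc m * Pa ≤ (m + 1) * Pa := by gcongr; exact le_self_add
      _ ≤ T := by rw [hT, add_assoc]; exact le_self_add
  have hT3 : Cc * Pe ^ 2 ≤ T ^ 2 := by
    have h1 : Cc * Pe ^ 2 ≤ T := by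
      rw [hT, add_right_comm]; exact le_add_self
    have h2 : 1 ≤ T := le_add_self
    calc Cc * Pe ^ 2 ≤ T * 1 := by rw [mul_one]; exact h1
      _ ≤ T * T := by gcongr
      _ = _ := by ring
  set L := ENNReal.ofReal (1 / (2 * δ)) ^ (1 / 2 : ℝ) with hL
  have hLf : L ≠ ⊤ := ENNReal.rpow_ne_top_of_nonneg (by norm_num) (by finiteness)
  have hCf : 2 * (T + T * L) + 1 ≠ ⊤ := by finiteness
  refine ⟨(2 * (T + T * L) + 1).toReal, ENNReal.toReal_pos (by simp) hCf, ?_⟩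
  intro f hf hN x₀ hx₀
  rw [ENNReal.ofReal_toReal hCf]
  have hmk : ∀ j, ∃ f' : EuclideanSpace ℝ (Fin n) → ℝ, Measurable f' ∧ f j =ᵐ[volume] f' := fun j =>
    ⟨(hf j).aestronglyMeasurable.aemeasurable.mk (f j),
      (hf j).aestronglyMeasurable.aemeasurable.measurable_mk,
      (hf j).aestronglyMeasurable.aemeasurable.ae_eq_mk⟩
  choose f' hf'm hff using hmk
  have hosc : ∀ j, OscBd n (f' j) (ballAvg n (f j)) 1 (bmoNorm n (f j)) := fun j =>
    osc_rep n (f j) (f' j) (hf j) (hff j)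
  set N : Fin m → ℝ≥0∞ := fun j => bmoNorm n (f j) with hNdef
  have hNf : ∀ j, N j ≠ ⊤ := fun j => (hN j).ne
  set P := ∏ j, N j with hP
  have hPf : P ≠ ⊤ := ENNReal.prod_ne_top fun j _ => hNf j
  set F : ℝ → EuclideanSpace ℝ (Fin n) → ℝ := fun t x => ∏ j, GG n (mkK n (Ω j)) (f' j) t x with hFdef
  have hG := fun j => hab j (f' j) (hf'm j) (ballAvg n (f j)) (N j) (hNf j) (hosc j)
  have hsF : ∀ t : ℝ, 0 < t → ∀ x, sFt n m Ω f t x = F t x := by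
    intro t ht x
    have e : ∀ j, ∫ y in closedBall (0 : EuclideanSpace ℝ (Fin n)) t,
        Ω j y / ‖y‖ ^ ((n : ℝ) - 1) * f j (x - y) = t * GG n (mkK n (Ω j)) (f' j) t x := fun j =>
      int_rep n hn (Ω j) (f j) (f' j) (hΩhom j) (hff j) t ht x
    unfold sFt
    simp only [e]
    rw [Finset.prod_mul_distrib, Finset.prod_const, Finset.card_univ, Fintype.card_fin,
      Real.rpow_neg ht.le, Real.rpow_natCast, ← mul_assoc, inv_mul_cancel₀ (by positivity), one_mul]
  have hsm : ∀ x, smarc n m Ω f x = (II n F (Set.Ioi 0) x) ^ (1 / 2 : ℝ) := by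
    intro x
    unfold smarc II
    congr 1
    apply setLIntegral_congr_fun measurableSet_Ioi
    intro t ht
    have ht0 : (0:ℝ) < t := ht
    simp only
    rw [hsF t ht0 x, div_eq_mul_one_div, ENNReal.ofReal_mul (sq_nonneg _), ← sq_abs,
      ENNReal.ofReal_pow (abs_nonneg _), Real.enorm_eq_ofReal_abs]
  have hFm : Measurable (fun q : EuclideanSpace ℝ (Fin n) × ℝ => F q.2 q.1) := by
    apply Finset.measurable_prod
    intro j _
    exact T_meas' n (mkK n (Ω j)) (f' j) (hK j).meas (hf'm j)
  have hPP : ∏ j, Ca j * N j = Pa * P := Finset.prod_mul_distrib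
  have ha : ∀ t : ℝ, 0 < t → ∀ x : EuclideanSpace ℝ (Fin n), ‖F t x‖ₑ ≤ T * P := by
    intro t ht x
    have h1 := (prod_diff Finset.univ (fun j => GG n (mkK n (Ω j)) (f' j) t x)
      (fun j => GG n (mkK n (Ω j)) (f' j) t x) (fun j => Ca j * N j) 0 (fun j => (hG j t ht x).2.1)
      (fun j => (hG j t ht x).2.1) (fun j => by simp)).1
    rw [hPP] at h1
    exact h1.trans (by gcongr)
  have hb : ∀ t : ℝ, 0 < t → ∀ x x' : EuclideanSpace ℝ (Fin n), ‖x - x'‖ ≤ t →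
      ‖F t x' - F t x‖ₑ ≤ T * P * ENNReal.ofReal ((‖x - x'‖ / t) ^ δ) := by
    intro t ht x x' hxx
    have h1 := (prod_diff Finset.univ (fun j => GG n (mkK n (Ω j)) (f' j) t x')
      (fun j => GG n (mkK n (Ω j)) (f' j) t x) (fun j => Ca j * N j)
      (ENNReal.ofReal ((‖x - x'‖ / t) ^ δ)) (fun j => (hG j t ht x').2.1)
      (fun j => (hG j t ht x).2.1) (fun j => (hG j t ht x).2.2 x' hxx)).2
    rw [hPP, Finset.card_univ, Fintype.card_fin, ← mul_assoc] at h1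
    exact h1.trans (by gcongr)
  have hPe2 : ∏ j ∈ Finset.univ.erase j₀, Ca j * N j = Pe * ∏ j ∈ Finset.univ.erase j₀, N j :=
    Finset.prod_mul_distrib
  have hPN : N j₀ * ∏ j ∈ Finset.univ.erase j₀, N j = P := Finset.mul_prod_erase _ _ (Finset.mem_univ _)
  have hNe : ∏ j ∈ Finset.univ.erase j₀, N j ≠ ⊤ := ENNReal.prod_ne_top fun j _ => hNf j
  set Q := ∏ j ∈ Finset.univ.erase j₀, N j with hQ
  have hpt : ∀ t : ℝ, 0 < t → ∀ x, ‖F t x‖ₑ ≤ ‖GG n (mkK n (Ω j₀)) (f' j₀) t x‖ₑ * (Pe * Q) := by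
    intro t ht x
    have h1 := (prod_diff (Finset.univ.erase j₀) (fun j => GG n (mkK n (Ω j)) (f' j) t x)
      (fun j => GG n (mkK n (Ω j)) (f' j) t x) (fun j => Ca j * N j) 0 (fun j => (hG j t ht x).2.1)
      (fun j => (hG j t ht x).2.1) (fun j => by simp)).1
    rw [hPe2] at h1
    have h2 : F t x = GG n (mkK n (Ω j₀)) (f' j₀) t x *
        ∏ j ∈ Finset.univ.erase j₀, GG n (mkK n (Ω j)) (f' j) t x :=
      (Finset.mul_prod_erase _ _ (Finset.mem_univ _)).symm
    rw [h2, enorm_mul]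
    gcongr
  have hc : ∀ (c : EuclideanSpace ℝ (Fin n)) (r : ℝ), 0 < r →
      ∫⁻ x in closedBall c r, II n F (Set.Ioc 0 r) x ≤ (T * P) ^ 2 * volume (closedBall c r) := by
    intro c r hr
    have h1 := hcc (f' j₀) (hf'm j₀) (ballAvg n (f j₀)) (N j₀) (hNf j₀) (hosc j₀) c r hr
    have hfin : (Pe * Q) ^ 2 ≠ ⊤ := by finiteness
    calc _ ≤ ∫⁻ x in closedBall c r, (Pe * Q) ^ 2 * ∫⁻ t in Set.Ioc (0:ℝ) r,
            ‖GG n (mkK n (Ω j₀)) (f' j₀) t x‖ₑ ^ 2 * ENNReal.ofReal (1 / t) := by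
          refine lintegral_mono fun x => ?_
          rw [← lintegral_const_mul' _ _ hfin]
          apply setLIntegral_mono' measurableSet_Ioc
          intro t ht
          calc _ ≤ (‖GG n (mkK n (Ω j₀)) (f' j₀) t x‖ₑ * (Pe * Q)) ^ 2 * ENNReal.ofReal (1 / t) := by
                gcongr; exact hpt t ht.1 x
            _ = _ := by ring
      _ = (Pe * Q) ^ 2 * ∫⁻ x in closedBall c r, ∫⁻ t in Set.Ioc (0:ℝ) r,
            ‖GG n (mkK n (Ω j₀)) (f' j₀) t x‖ₑ ^ 2 * ENNReal.ofReal (1 / t) :=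
          lintegral_const_mul' _ _ hfin
      _ ≤ (Pe * Q) ^ 2 * (Cc * N j₀ ^ 2 * volume (closedBall c r)) := by gcongr
      _ = (Cc * Pe ^ 2) * (N j₀ * Q) ^ 2 * volume (closedBall c r) := by ring
      _ ≤ T ^ 2 * P ^ 2 * volume (closedBall c r) := by rw [hPN]; gcongr
      _ = _ := by ring
  have h0 : II n F (Set.Ioi 0) x₀ ≠ ⊤ := by
    intro h
    rw [hsm, h, ENNReal.top_rpow_of_pos (by norm_num)] at hx₀
    exact lt_irrefl _ hx₀
  have hfinal := assemble n F hFm (T * P) δ hδ0 (by finiteness) ha hb hc x₀ h0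
  simp only [hsm]
  refine ⟨hfinal.1, hfinal.2.trans ?_⟩
  rw [← hL]
  calc 2 * (T * P + T * P * L) = 2 * (T + T * L) * P := by ring
    _ ≤ (2 * (T + T * L) + 1) * P := by gcongr; exact le_self_add
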